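/- arXiv:2407.02582 — 3 statements merged into one kernel-verified Lean document; each statement's English description precedes it below -/
import Mathlib

section
/- Let f: ℝ → [0,1] be smooth with supp f ⊂ [−7/4, 7/4] and f = 1 on [−5/4, 5/4], let λ₀ ∈ ℕ, λ₀ ≥ 1, and δ₀ > 0. Define on 𝕋² × ℝ: θ₀(x,t) = f(t) δ₀^{1/2} λ₀^{1/2} cos(λ₀ x₁), u₀ = ∇^⊥Λ^{−1}θ₀ (a vector field parallel to e₂, so that u₀·∇θ₀ = 0), and R₀(x,t) = −f′(t) δ₀^{1/2} λ₀^{−3/2} M(x) with M₁₁ = M₂₂ = 0 and M₁₂ = M₂₁ = cos(λ₀ x₁). Then R₀ is a symmetric trace-free 2×2 tensor field, and the triple (θ₀, u₀, R₀) solves the SQG–Reynolds system: ∂_tθ₀ + u₀·∇θ₀ = ∇^⊥·div R₀ with u₀ = ∇^⊥Λ^{−1}θ₀. -/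
/-!
Common setup: functions on the torus `𝕋^d = ℝ^d/(2πℤ)^d` are modelled as
`2π`-periodic functions on `ℝ^d = Fin d → ℝ`, with Fourier coefficients,
Fourier multiplier operators, Hölder norms, etc.
-/

noncomputable section

open scoped BigOperators
open MeasureTheory

/-- Points of `ℝ^d` (covering the torus `𝕋^d = ℝ^d/(2πℤ)^d`). -/
abbrev Vd (d : ℕ) := Fin d → ℝ

/-- The lattice vector `2π m`. -/
def latt {d : ℕ} (m : Fin d → ℤ) : Vd d := fun i => 2 * Real.pi * (m i : ℝ)

/-- `f` is `2π`-periodic in each coordinate, i.e. a function on the torus `𝕋^d`. -/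
def TorusFun {d : ℕ} {F : Type*} (f : Vd d → F) : Prop :=
  ∀ (x : Vd d) (m : Fin d → ℤ), f (x + latt m) = f x

/-- Dot product of an integer frequency with a point of `ℝ^d`. -/
def dotZ {d : ℕ} (k : Fin d → ℤ) (x : Vd d) : ℝ := ∑ i, (k i : ℝ) * x i

/-- The Euclidean norm on `ℝ^d`. -/
def eNorm {d : ℕ} (x : Vd d) : ℝ := Real.sqrt (∑ i, (x i) ^ 2)

/-- `|k|` for an integer frequency `k ∈ ℤ^d`. -/
def kAbs {d : ℕ} (k : Fin d → ℤ) : ℝ := eNorm (fun i => (k i : ℝ))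

/-- The fundamental domain `[0,2π]^d`. -/
def box (d : ℕ) : Set (Vd d) := Set.Icc 0 (fun _ => 2 * Real.pi)

/-- Mean-zero (real-valued) function on the torus. -/
def MeanZeroR {d : ℕ} (f : Vd d → ℝ) : Prop := ∫ x in box d, f x = 0

/-- Fourier coefficient `f̂(k)` of a function on the torus. -/
def fCoeff {d : ℕ} (f : Vd d → ℂ) (k : Fin d → ℤ) : ℂ :=
  (((2 * Real.pi) ^ d)⁻¹ : ℝ) • ∫ x in box d, f x * Complex.exp (-(Complex.I * (dotZ k x : ℂ)))

/-- Fourier multiplier operator with symbol `m : ℤ^d → ℂ`. -/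
def fmul {d : ℕ} (m : (Fin d → ℤ) → ℂ) (f : Vd d → ℂ) : Vd d → ℂ :=
  fun x => ∑' k : Fin d → ℤ, m k * fCoeff f k * Complex.exp (Complex.I * (dotZ k x : ℂ))

/-- `Λ^s = (-Δ)^{s/2}`: Fourier multiplier with symbol `|k|^s` (acting on mean-zero parts). -/
def LamPow {d : ℕ} (s : ℝ) : (Vd d → ℂ) → Vd d → ℂ :=
  fmul (fun k => if k = 0 then 0 else (((kAbs k) ^ s : ℝ) : ℂ))

/-- `Λ = (-Δ)^{1/2}`. -/
def Lam1 {d : ℕ} : (Vd d → ℂ) → Vd d → ℂ := LamPow 1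

/-- `i`-th component of the SQG operator `∇^⊥Λ^{-1} = (-∂₂Λ^{-1}, ∂₁Λ^{-1})`,
with symbols `(-i k₂/|k|, i k₁/|k|)`. -/
def sqgOp (i : Fin 2) : (Vd 2 → ℂ) → Vd 2 → ℂ :=
  fmul (fun k => if k = 0 then 0 else
    (if i = 0 then -(Complex.I * (k 1 : ℂ)) else Complex.I * (k 0 : ℂ)) / ((kAbs k : ℝ) : ℂ))

/-- First-order partial derivative `∂_i`. -/
def pd {d : ℕ} {F : Type*} [NormedAddCommGroup F] [NormedSpace ℝ F]
    (i : Fin d) (f : Vd d → F) (x : Vd d) : F :=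
  fderiv ℝ f x (Pi.single i 1)

/-- Complexification of a real-valued function. -/
def cplx {d : ℕ} (f : Vd d → ℝ) : Vd d → ℂ := fun x => (f x : ℂ)

/-- The `C^N` norm: sum of sup-norms of the iterated derivatives of order `≤ N`. -/
def CkNorm {d : ℕ} {F : Type*} [NormedAddCommGroup F] [NormedSpace ℝ F]
    (N : ℕ) (f : Vd d → F) : ℝ :=
  ∑ n ∈ Finset.range (N + 1), ⨆ x : Vd d, ‖iteratedFDeriv ℝ n f x‖

/-- The `α`-Hölder seminorm. -/
def hSemi {d : ℕ} {F : Type*} [NormedAddCommGroup F] (α : ℝ) (f : Vd d → F) : ℝ :=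
  ⨆ p : Vd d × Vd d, if p.1 = p.2 then 0 else ‖f p.1 - f p.2‖ / ‖p.1 - p.2‖ ^ α

/-- The `C^{N,α}` Hölder norm `‖f‖_{N+α}`. -/
def HolNorm {d : ℕ} {F : Type*} [NormedAddCommGroup F] [NormedSpace ℝ F]
    (N : ℕ) (α : ℝ) (f : Vd d → F) : ℝ :=
  CkNorm N f + hSemi α (iteratedFDeriv ℝ N f)

/-- `∇^⊥·div R` for a `2`-tensor field `R` on `ℝ²` (values in any normed space). -/
def perpDivDiv {F : Type*} [NormedAddCommGroup F] [NormedSpace ℝ F]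
    (R : Vd 2 → Fin 2 → Fin 2 → F) (x : Vd 2) : F :=
  - pd 1 (fun y => ∑ j, pd j (fun z => R z 0 j) y) x
  + pd 0 (fun y => ∑ j, pd j (fun z => R z 1 j) y) x

/-- Material derivative `D_t f = ∂_t f + u·∇f`. -/
def matD (u : ℝ → Vd 2 → Fin 2 → ℝ) (f : ℝ → Vd 2 → ℝ) (t : ℝ) (x : Vd 2) : ℝ :=
  deriv (fun s => f s x) t + ∑ i, u t x i * pd i (f t) x

/-- The SQG–Reynolds system `∂_tθ + u·∇θ = ∇^⊥·div R`, `u = ∇^⊥Λ^{-1}θ`,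
for smooth space-periodic data with `R` symmetric. -/
structure SQGReynolds (θ : ℝ → Vd 2 → ℝ) (u : ℝ → Vd 2 → Fin 2 → ℝ)
    (R : ℝ → Vd 2 → Fin 2 → Fin 2 → ℝ) : Prop where
  smooth_θ : ContDiff ℝ (⊤ : ℕ∞) fun p : ℝ × Vd 2 => θ p.1 p.2
  smooth_u : ContDiff ℝ (⊤ : ℕ∞) fun p : ℝ × Vd 2 => u p.1 p.2
  smooth_R : ContDiff ℝ (⊤ : ℕ∞) fun p : ℝ × Vd 2 => R p.1 p.2
  periodic_θ : ∀ t, TorusFun (θ t)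
  periodic_u : ∀ t, TorusFun (u t)
  periodic_R : ∀ t, TorusFun (R t)
  symm_R : ∀ t x i j, R t x i j = R t x j i
  vel : ∀ t x i, (u t x i : ℂ) = sqgOp i (cplx (θ t)) x
  eqn : ∀ t x, matD u θ t x = perpDivDiv (R t) x

/-- The bilinear operator `T[f,g] = Λ^{-1}((Λf)g - f(Λg))`. -/
def Tbil (f g : Vd 2 → ℂ) : Vd 2 → ℂ :=
  LamPow (-1) (fun x => Lam1 f x * g x - f x * Lam1 g x)

/-- A Littlewood–Paley bump: smooth, spherically symmetric, `ψ = 1` on `B₁(0)`,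
`supp ψ ⊂ B_{3/2}(0)`. -/
structure LPfun {d : ℕ} (ψ : Vd d → ℝ) : Prop where
  smooth : ContDiff ℝ (⊤ : ℕ∞) ψ
  radial : ∀ x y : Vd d, eNorm x = eNorm y → ψ x = ψ y
  supp : ∀ x, 3/2 ≤ eNorm x → ψ x = 0
  one : ∀ x, eNorm x ≤ 1 → ψ x = 1

/-- Littlewood–Paley block `Δ_j f` (with `Δ_{-1}f = f̂(0)`, `Δ_j f = 0` for `j < -1`). -/
def LPblock {d : ℕ} (ψ : Vd d → ℝ) (j : ℤ) (f : Vd d → ℂ) : Vd d → ℂ :=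
  if j < -1 then 0
  else if j = -1 then fun _ => fCoeff f 0
  else fun x => ∑' k : Fin d → ℤ,
    (((ψ (fun i => (k i : ℝ) / 2 ^ j) - ψ (fun i => (k i : ℝ) / 2 ^ (j - 1))) : ℝ) : ℂ)
      * fCoeff f k * Complex.exp (Complex.I * (dotZ k x : ℂ))

/-- Low-frequency projection `S_j f = Σ_{i ≤ j} Δ_i f`. -/
def LPlow {d : ℕ} (ψ : Vd d → ℝ) (j : ℤ) (f : Vd d → ℂ) : Vd d → ℂ :=
  if j < -1 then 0
  else if j = -1 then fun _ => fCoeff f 0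
  else fun x => ∑' k : Fin d → ℤ,
    ((ψ (fun i => (k i : ℝ) / 2 ^ j) : ℝ) : ℂ)
      * fCoeff f k * Complex.exp (Complex.I * (dotZ k x : ℂ))

/-- The partial derivatives of a function of the first coordinate alone. -/
theorem pd_comp_coord_zero {g : ℝ → ℝ} {g' : ℝ} {x : Vd 2} (hg : HasDerivAt g g' (x 0))
    (i : Fin 2) : pd i (fun y : Vd 2 => g (y 0)) x = if i = 0 then g' else 0 := by
  have h : HasFDerivAt (fun y : Vd 2 => y 0) (ContinuousLinearMap.proj 0 : Vd 2 →L[ℝ] ℝ) x :=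
    (ContinuousLinearMap.proj 0 : Vd 2 →L[ℝ] ℝ).hasFDerivAt
  unfold pd
  have hc : HasFDerivAt (fun y : Vd 2 => g (y 0)) _ x := hg.comp_hasFDerivAt x h
  rw [hc.fderiv]
  fin_cases i <;> simp

/-- Nonconstant characters have zero mean over a period. -/
theorem integral_Icc_exp_neg_intCast_mul {k : ℤ} (hk : k ≠ 0) :
    ∫ y in Set.Icc (0 : ℝ) (2 * Real.pi), Complex.exp (-(Complex.I * ((k : ℝ) * y : ℝ))) = 0 := by
  have hc : -(Complex.I * (k : ℂ)) ≠ 0 := by simp [hk]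
  rw [integral_Icc_eq_integral_Ioc, ← intervalIntegral.integral_of_le (by positivity)]
  have h := integral_exp_mul_complex (a := 0) (b := 2 * Real.pi) hc
  have h1 : Complex.exp (-(Complex.I * (k : ℂ)) * ((2 * Real.pi : ℝ) : ℂ)) = 1 := by
    rw [Complex.exp_eq_one_iff]
    exact ⟨-k, by push_cast; ring⟩
  rw [h1] at h
  simp only [Complex.ofReal_zero, mul_zero, Complex.exp_zero, sub_self, zero_div] at h
  rw [← h]
  congr 1
  ext y
  push_cast
  ring_nf

/-- A function of the first coordinate alone has no Fourier modes in the second coordinate. -/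
theorem fCoeff_comp_coord_zero (F : ℝ → ℂ) {k : Fin 2 → ℤ} (hk : k 1 ≠ 0) :
    fCoeff (fun x : Vd 2 => F (x 0)) k = 0 := by
  let g : Fin 2 → ℝ → ℂ := fun i y =>
    (if i = 0 then F y else 1) * Complex.exp (-(Complex.I * ((k i : ℝ) * y : ℝ)))
  have hg : (fun x : Vd 2 => F (x 0) * Complex.exp (-(Complex.I * (dotZ k x : ℂ))))
      = fun x => ∏ i, g i (x i) := by
    ext x
    simp only [g, dotZ, Fin.prod_univ_two, Fin.sum_univ_two, if_true, one_ne_zero, if_false,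
      one_mul, mul_assoc, ← Complex.exp_add]
    push_cast
    ring_nf
  have hbox : (volume : Measure (Vd 2)).restrict (box 2)
      = Measure.pi fun _ => volume.restrict (Set.Icc (0 : ℝ) (2 * Real.pi)) := by
    rw [box, ← Set.pi_univ_Icc, volume_pi, Measure.restrict_pi_pi]
    rfl
  have h1 : ∫ y in Set.Icc (0 : ℝ) (2 * Real.pi), g 1 y = 0 := by
    simpa [g] using integral_Icc_exp_neg_intCast_mul hk
  rw [fCoeff, hg, hbox, integral_fintype_prod_eq_prod, Fin.prod_univ_two, h1, mul_zero, smul_zero]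

/-- `-∂₂Λ⁻¹` kills functions of the first coordinate alone. -/
theorem sqgOp_zero_comp_coord_zero (F : ℝ → ℂ) (x : Vd 2) :
    sqgOp 0 (fun y => F (y 0)) x = 0 := by
  unfold sqgOp fmul
  refine (tsum_congr fun k => ?_).trans tsum_zero
  by_cases hk : k 1 = 0
  · simp [hk]
  · rw [fCoeff_comp_coord_zero F hk, mul_zero, zero_mul]

/-- `∇^⊥·div` of an off-diagonal tensor depending on the first coordinate alone. -/
theorem perpDivDiv_offDiag {g g' g'' : ℝ → ℝ} (hg : ∀ y, HasDerivAt g (g' y) y)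
    (hg' : ∀ y, HasDerivAt g' (g'' y) y) (x : Vd 2) :
    perpDivDiv (fun (z : Vd 2) i j => if i ≠ j then g (z 0) else 0) x = g'' (x 0) := by
  have hzero : ∀ (i : Fin 2) (y : Vd 2), pd i (fun _ : Vd 2 => (0 : ℝ)) y = 0 := by
    intro i y
    simp [pd]
  simp only [perpDivDiv, Fin.sum_univ_two, ne_eq, not_true_eq_false, if_false, zero_ne_one,
    one_ne_zero, not_false_eq_true, if_true, hzero, pd_comp_coord_zero (hg _), add_zero, zero_add,
    neg_zero, pd_comp_coord_zero (hg' _)]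

/-- The base case of the iteration: with
`θ₀(x,t) = f(t) δ₀^{1/2} λ₀^{1/2} cos(λ₀x₁)`, `u₀ = ∇^⊥Λ^{-1}θ₀`, and
`R₀ = -f'(t) δ₀^{1/2} λ₀^{-3/2} M(x)` (`M` off-diagonal `cos(λ₀x₁)`),
`R₀` is symmetric and trace-free, `u₀` is parallel to `e₂` (so `u₀·∇θ₀ = 0`),
and `(θ₀,u₀,R₀)` solves the SQG–Reynolds system. -/
theorem base_case_solves_SQG_Reynolds
    (f : ℝ → ℝ) (hf_sm : ContDiff ℝ (⊤ : ℕ∞) f) (hf_rng : ∀ t, f t ∈ Set.Icc (0:ℝ) 1)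
    (hf_supp : ∀ t, t ∉ Set.Icc (-(7/4) : ℝ) (7/4) → f t = 0)
    (hf_one : ∀ t ∈ Set.Icc (-(5/4) : ℝ) (5/4), f t = 1)
    (lam0 : ℕ) (hlam0 : 1 ≤ lam0) (δ0 : ℝ) (hδ0 : 0 < δ0)
    (θ0 : ℝ → Vd 2 → ℝ) (u0 : ℝ → Vd 2 → Fin 2 → ℝ) (R0 : ℝ → Vd 2 → Fin 2 → Fin 2 → ℝ)
    (hθ0 : ∀ t x, θ0 t x =
      f t * δ0 ^ ((1:ℝ)/2) * (lam0 : ℝ) ^ ((1:ℝ)/2) * Real.cos (lam0 * x 0))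
    (hu0 : ∀ t x i, (u0 t x i : ℂ) = sqgOp i (cplx (θ0 t)) x)
    (hR0 : ∀ t x i j, R0 t x i j =
      - deriv f t * δ0 ^ ((1:ℝ)/2) * (lam0 : ℝ) ^ (-(3:ℝ)/2) *
        (if i ≠ j then Real.cos (lam0 * x 0) else 0)) :
    (∀ t x i j, R0 t x i j = R0 t x j i) ∧
    (∀ t x, (∑ i, R0 t x i i) = 0) ∧
    (∀ t x, u0 t x 0 = 0) ∧
    (∀ t x, (∑ i, u0 t x i * pd i (θ0 t) x) = 0) ∧
    (∀ t x, matD u0 θ0 t x = perpDivDiv (R0 t) x) := by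
  have hlam : (0 : ℝ) < lam0 := by exact_mod_cast hlam0
  have hθ : ∀ t, θ0 t = fun x : Vd 2 =>
      f t * δ0 ^ ((1:ℝ)/2) * (lam0 : ℝ) ^ ((1:ℝ)/2) * Real.cos (lam0 * x 0) :=
    fun t => funext (hθ0 t)
  have hlin : ∀ y : ℝ, HasDerivAt (fun y : ℝ => (lam0 : ℝ) * y) lam0 y := fun y => by
    simpa using (hasDerivAt_id y).const_mul (lam0 : ℝ)
  have hcos : ∀ c y : ℝ, HasDerivAt (fun y => c * Real.cos (lam0 * y))
      (c * (-Real.sin (lam0 * y) * lam0)) y := fun c y => (hlin y).cos.const_mul c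
  have hsin : ∀ c y : ℝ, HasDerivAt (fun y => c * (-Real.sin (lam0 * y) * lam0))
      (c * (-(Real.cos (lam0 * y) * lam0) * lam0)) y :=
    fun c y => ((hlin y).sin.neg.mul_const _).const_mul c
  have hu : ∀ t x, u0 t x 0 = 0 := by
    intro t x
    have h := hu0 t x 0
    rw [hθ] at h
    exact_mod_cast h.trans (sqgOp_zero_comp_coord_zero (fun y =>
      ((f t * δ0 ^ ((1:ℝ)/2) * (lam0 : ℝ) ^ ((1:ℝ)/2) * Real.cos (lam0 * y) : ℝ) : ℂ)) x)
  have hadv : ∀ t x, (∑ i, u0 t x i * pd i (θ0 t) x) = 0 := by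
    intro t x
    rw [Fin.sum_univ_two, hu, hθ, pd_comp_coord_zero (hcos _ _) 1]
    simp
  refine ⟨fun t x i j => ?_, fun t x => ?_, hu, hadv, fun t x => ?_⟩
  · simp only [hR0, ne_comm]
  · simp [hR0]
  · have hR : R0 t = fun (z : Vd 2) i j => if i ≠ j then
        (-deriv f t * δ0 ^ ((1:ℝ)/2) * (lam0 : ℝ) ^ (-(3:ℝ)/2)) * Real.cos (lam0 * z 0) else 0 := by
      ext z i j
      rw [hR0, mul_ite, mul_zero]
    have hpow : (lam0 : ℝ) ^ ((1:ℝ)/2) = (lam0 : ℝ) ^ (-(3:ℝ)/2) * (lam0 * lam0) := by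
      rw [← sq, ← Real.rpow_natCast, ← Real.rpow_add hlam]
      norm_num
    have hf : HasDerivAt f (deriv f t) t :=
      ((hf_sm.differentiable (by simp)) t).hasDerivAt
    have hdt : deriv (fun s => θ0 s x) t
        = deriv f t * δ0 ^ ((1:ℝ)/2) * (lam0 : ℝ) ^ ((1:ℝ)/2) * Real.cos (lam0 * x 0) := by
      simp only [hθ0]
      exact (((hf.mul_const _).mul_const _).mul_const _).deriv
    rw [matD, hadv, add_zero, hdt, hR, perpDivDiv_offDiag (hcos _) (hsin _), hpow]
    ring
end
end

section
/- Let λ ∈ ℕ, ξ ∈ ℤ²∖{0}, a: 𝕋² → ℝ smooth, and Φ: 𝕋² → 𝕋² a smooth diffeomorphism such that ∇Φ(x)^T ξ ∈ A for every x ∈ 𝕋², where A is the annulus used in defining P_{≈λ}. Set θ_ξ(x) = P_{≈λ}[a(x) cos(λ Φ(x)·ξ)]. Define Θ′_η(x) = a(x) e^{iλΦ(x)·η} for η ∈ {ξ,−ξ}, and define the 2×2 tensor field B_λ(x) = (1/16) Σ_{η,ζ ∈ {ξ,−ξ}} Σ_{j,k ∈ ℤ²} [((j−k)⊗(j−k))/(|k||j|(|k|+|j|))]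 χ_λ(k) χ_λ(j) Θ̂′_η(k) Θ̂′_ζ(j) e^{i(j+k)·x} (the sum runs over frequencies in supp χ_λ, which avoids the origin). Then B_λ is a smooth symmetric 2×2 tensor field satisfying ∇^⊥Λ^{−1}θ_ξ · ∇θ_ξ = ∇^⊥·div B_λ, and B_λ admits the expansion B_λ(x) = (1/4) a(x)² (∇Φ(x)^Tξ ⊗ ∇Φ(x)^Tξ)/(λ|∇Φ(x)^Tξ|³) + δB_λ(x), where δB_λ = Σ_{η,ζ∈{ξ,−ξ}} e^{iλΦ(x)·(η+ζ)} ∫_{ℝ²×ℝ²} Y_λ^{η,ζ}(x,h₁,h₂) K_λ(h₁,h₂) e^{−iλ(∇Φ(x)^Tη)·h₁} e^{−iλ(∇Φ(x)^Tζ)·h₂} dh₁dh₂, with Y_λ^{η,ζ}(x,h₁,h₂) = a(x)(Y_λ^η(x,h₁) + Y_λ^ζ(x,h₂)) + Y_λ^η(x,h₁)Y_λ^ζ(x,h₂), Y_λ^η(x,h) = a(x−h)e^{iλR_Φ(x,h)·η} − a(x), and R_Φ(x,h) = Φ(x−h) − Φ(x) + ∇Φ(x)h the second-order Taylor remainder of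 Φ. -/
/-!
Common setup: functions on the torus `𝕋^d = ℝ^d/(2πℤ)^d` are modelled as
`2π`-periodic functions on `ℝ^d = Fin d → ℝ`, with Fourier coefficients,
Fourier multiplier operators, Hölder norms, etc.
-/

noncomputable section

open scoped BigOperators
open MeasureTheory

/-- `∇Φ(x)^T ξ`, for an integer direction `ξ`. -/
def gradT (Φ : Vd 2 → Vd 2) (ξ : Fin 2 → ℤ) (x : Vd 2) : Vd 2 :=
  fun i => ∑ j, pd i (fun y => Φ y j) x * (ξ j : ℝ)

/-- The tensor-valued symbol
`K̂_λ(ν₁,ν₂) = (1/16) ((ν₁-ν₂)⊗(ν₁-ν₂))/(|ν₁||ν₂|(|ν₁|+|ν₂|)) χ(ν₁/λ)χ(ν₂/λ)`. -/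
def Khat (χ : Vd 2 → ℝ) (lam : ℕ) (ν₁ ν₂ : Vd 2) (i j : Fin 2) : ℝ :=
  (1/16) * ((ν₁ i - ν₂ i) * (ν₁ j - ν₂ j))
    / (eNorm ν₁ * eNorm ν₂ * (eNorm ν₁ + eNorm ν₂))
    * χ (fun l => ν₁ l / (lam : ℝ)) * χ (fun l => ν₂ l / (lam : ℝ))

/-- The physical-space kernel
`K_λ(h₁,h₂) = (1/(16(2π)⁴)) ∫ ((ν₁-ν₂)⊗(ν₁-ν₂))/(|ν₁||ν₂|(|ν₁|+|ν₂|)) χ_λ(ν₁)χ_λ(ν₂)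
e^{i(ν₁·h₁+ν₂·h₂)} dν₁dν₂` (the integrand below is `16·K̂_λ`). -/
def Kker (χ : Vd 2 → ℝ) (lam : ℕ) (h : Vd 2 × Vd 2) : Fin 2 → Fin 2 → ℂ :=
  fun i j => ((16 * (2 * Real.pi) ^ 4 : ℝ))⁻¹ •
    ∫ ν : Vd 2 × Vd 2,
      ((16 * Khat χ lam ν.1 ν.2 i j : ℝ) : ℂ)
        * Complex.exp (Complex.I * (((∑ l, ν.1 l * h.1 l) + ∑ l, ν.2 l * h.2 l : ℝ) : ℂ))

/-- Frequency projection `P_{≈λ}` onto an annulus of radii `≈ λ`. -/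
def Pproj (χ : Vd 2 → ℝ) (lam : ℕ) (f : Vd 2 → ℂ) : Vd 2 → ℂ :=
  fun x => ∑' k : Fin 2 → ℤ,
    ((χ (fun i => (k i : ℝ) / (lam : ℝ)) : ℝ) : ℂ)
      * fCoeff f k * Complex.exp (Complex.I * (dotZ k x : ℂ))

/-- `∇Φ(x)h` (the Jacobian applied to a vector `h`). -/
def gradMul (Φ : Vd 2 → Vd 2) (x h : Vd 2) : Vd 2 :=
  fun i => ∑ j, pd j (fun y => Φ y i) x * h j

/-- The second-order Taylor remainder `R_Φ(x,h) = Φ(x-h) - Φ(x) + ∇Φ(x)h`. -/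
def RPhi (Φ : Vd 2 → Vd 2) (x h : Vd 2) : Vd 2 :=
  Φ (x - h) - Φ x + gradMul Φ x h

/-- `Θ'_η(x) = a(x) e^{iλΦ(x)·η}`. -/
def Thp (a : Vd 2 → ℝ) (Φ : Vd 2 → Vd 2) (lam : ℕ) (η : Fin 2 → ℤ) (x : Vd 2) : ℂ :=
  (a x : ℂ) * Complex.exp (Complex.I * (((lam : ℝ) * ∑ j, Φ x j * (η j : ℝ) : ℝ) : ℂ))

/-- `Y_λ^η(x,h) = a(x-h) e^{iλR_Φ(x,h)·η} - a(x)`. -/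
def Ylam (a : Vd 2 → ℝ) (Φ : Vd 2 → Vd 2) (lam : ℕ) (η : Fin 2 → ℤ) (x h : Vd 2) : ℂ :=
  (a (x - h) : ℂ)
    * Complex.exp (Complex.I * (((lam : ℝ) * ∑ j, RPhi Φ x h j * (η j : ℝ) : ℝ) : ℂ))
  - (a x : ℂ)

/-- `Y_λ^{η,ζ}(x,h₁,h₂) = a(x)(Y_λ^η(x,h₁)+Y_λ^ζ(x,h₂)) + Y_λ^η(x,h₁)Y_λ^ζ(x,h₂)`. -/
def Ypair (a : Vd 2 → ℝ) (Φ : Vd 2 → Vd 2) (lam : ℕ) (η ζ : Fin 2 → ℤ)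
    (x h₁ h₂ : Vd 2) : ℂ :=
  (a x : ℂ) * (Ylam a Φ lam η x h₁ + Ylam a Φ lam ζ x h₂)
    + Ylam a Φ lam η x h₁ * Ylam a Φ lam ζ x h₂

/-- The symmetric tensor field `B_λ` of the bilinear microlocal lemma. -/
def Bfield (χ : Vd 2 → ℝ) (a : Vd 2 → ℝ) (Φ : Vd 2 → Vd 2) (lam : ℕ) (ξ : Fin 2 → ℤ)
    (x : Vd 2) (i i' : Fin 2) : ℂ :=
  (1/16 : ℂ) * ∑ η ∈ ({ξ, -ξ} : Finset (Fin 2 → ℤ)),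
    ∑ ζ ∈ ({ξ, -ξ} : Finset (Fin 2 → ℤ)),
      ∑' jk : (Fin 2 → ℤ) × (Fin 2 → ℤ),
        ((16 * Khat χ lam (fun l => (jk.1 l : ℝ)) (fun l => (jk.2 l : ℝ)) i i' : ℝ) : ℂ)
          * fCoeff (Thp a Φ lam η) jk.2 * fCoeff (Thp a Φ lam ζ) jk.1
          * Complex.exp (Complex.I * (dotZ (jk.1 + jk.2) x : ℂ))

/-- The explicit lower-order term `δB_λ` of the bilinear microlocal lemma. -/
def deltaB (χ : Vd 2 → ℝ) (a : Vd 2 → ℝ) (Φ : Vd 2 → Vd 2) (lam : ℕ) (ξ : Fin 2 → ℤ)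
    (x : Vd 2) (i i' : Fin 2) : ℂ :=
  ∑ η ∈ ({ξ, -ξ} : Finset (Fin 2 → ℤ)), ∑ ζ ∈ ({ξ, -ξ} : Finset (Fin 2 → ℤ)),
    Complex.exp (Complex.I * (((lam : ℝ) * ∑ j, Φ x j * ((η j + ζ j : ℤ) : ℝ) : ℝ) : ℂ))
      * ∫ h : Vd 2 × Vd 2,
          Ypair a Φ lam η ζ x h.1 h.2 * Kker χ lam h i i'
            * Complex.exp (-(Complex.I *
                (((lam : ℝ) * ∑ l, gradT Φ η x l * h.1 l : ℝ) : ℂ)))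
            * Complex.exp (-(Complex.I *
                (((lam : ℝ) * ∑ l, gradT Φ ζ x l * h.2 l : ℝ) : ℂ)))

/-- The exponential `x ↦ e^{ik·x}`. -/
def torusExp {d : ℕ} (k : Fin d → ℤ) (x : Vd d) : ℂ :=
  Complex.exp (Complex.I * (dotZ k x : ℂ))

lemma dotZ_add_left {d : ℕ} (j k : Fin d → ℤ) (x : Vd d) :
    dotZ (j + k) x = dotZ j x + dotZ k x := by
  simp [dotZ, add_mul, Finset.sum_add_distrib]

lemma torusExp_add {d : ℕ} (j k : Fin d → ℤ) (x : Vd d) :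
    torusExp (j + k) x = torusExp j x * torusExp k x := by
  simp only [torusExp, dotZ_add_left, ← Complex.exp_add]
  push_cast
  ring_nf

lemma contDiff_torusExp {d : ℕ} (k : Fin d → ℤ) : ContDiff ℝ (⊤ : ℕ∞) (torusExp k) := by
  unfold torusExp dotZ
  refine Complex.contDiff_exp.comp (contDiff_const.mul (Complex.ofRealCLM.contDiff.comp ?_))
  exact ContDiff.sum (s := Finset.univ) fun i _ => contDiff_const.mul (contDiff_apply ℝ ℝ i)

lemma pd_torusExp {d : ℕ} (k : Fin d → ℤ) (i : Fin d) (x : Vd d) :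
    pd i (torusExp k) x = Complex.I * (k i : ℂ) * torusExp k x := by
  have h : HasFDerivAt (fun y : Vd d => dotZ k y)
      (∑ l, (k l : ℝ) • ContinuousLinearMap.proj (R := ℝ) (φ := fun _ : Fin d => ℝ) l) x := by
    unfold dotZ
    refine HasFDerivAt.fun_sum fun l _ => ?_
    exact (hasFDerivAt_apply l x).const_mul (k l : ℝ)
  have h2 := ((Complex.ofRealCLM.hasFDerivAt.comp x h).const_mul Complex.I).cexp
  have h3 : fderiv ℝ (torusExp k) x = _ := h2.fderiv
  rw [pd, h3]
  simp [torusExp, Pi.single_apply]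
  ring

lemma pd_sum_torusExp {d : ℕ} {ι : Type*} (s : Finset ι) (c : ι → ℂ) (p : ι → Fin d → ℤ)
    (i : Fin d) :
    pd i (fun x => ∑ k ∈ s, c k * torusExp (p k) x)
      = fun x => ∑ k ∈ s, (c k * (Complex.I * (p k i : ℂ))) * torusExp (p k) x := by
  have hd (k : Fin d → ℤ) : Differentiable ℝ (torusExp k) :=
    (contDiff_torusExp k).differentiable (by simp)
  funext x
  rw [pd, fderiv_fun_sum fun k _ => ((hd (p k)).differentiableAt (x := x)).const_mul (c k)]
  rw [sum_apply]
  refine Finset.sum_congr rfl fun k _ => ?_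
  rw [fderiv_const_mul (hd _).differentiableAt]
  have := pd_torusExp (p k) i x
  rw [pd] at this
  simp only [smul_apply, this, smul_eq_mul]
  ring

lemma integral_Icc_exp_int (n : ℤ) :
    ∫ x in Set.Icc 0 (2 * Real.pi), Complex.exp (Complex.I * ((n : ℝ) * x : ℝ))
      = if n = 0 then ((2 * Real.pi : ℝ) : ℂ) else 0 := by
  rw [integral_Icc_eq_integral_Ioc, ← intervalIntegral.integral_of_le (by positivity)]
  split_ifs with h
  · simp [h]
  · have hc : Complex.I * (n : ℂ) ≠ 0 := by simp [h]
    have := integral_exp_mul_complex (a := 0) (b := 2 * Real.pi) hc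
    have e : ∀ x : ℝ, Complex.I * (((n : ℝ) * x : ℝ) : ℂ) = Complex.I * (n : ℂ) * x := by
      intro x; push_cast; ring
    simp_rw [e, this]
    have e2 : Complex.I * (n : ℂ) * ((2 * Real.pi : ℝ) : ℂ) = n * (2 * Real.pi * Complex.I) := by
      push_cast; ring
    rw [e2, Complex.exp_int_mul_two_pi_mul_I]
    simp

lemma integral_box_torusExp {d : ℕ} (k : Fin d → ℤ) :
    ∫ x in box d, torusExp k x = if k = 0 then (((2 * Real.pi) ^ d : ℝ) : ℂ) else 0 := by
  have e : ∀ x : Vd d, torusExp k x = ∏ l, Complex.exp (Complex.I * ((k l : ℝ) * x l : ℝ)) := by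
    intro x
    rw [← Complex.exp_sum, torusExp, dotZ, ← Finset.mul_sum]
    push_cast
    rfl
  have hb : (volume : Measure (Vd d)).restrict (box d)
      = Measure.pi fun _ => (volume : Measure ℝ).restrict (Set.Icc 0 (2 * Real.pi)) := by
    rw [box, ← Set.pi_univ_Icc, volume_pi, Measure.restrict_pi_pi]
    rfl
  simp_rw [e]
  rw [hb, integral_fintype_prod_eq_prod
    (f := fun (l : Fin d) (x : ℝ) => Complex.exp (Complex.I * ((k l : ℝ) * x : ℝ)))]
  simp_rw [integral_Icc_exp_int]
  split_ifs with h
  · simp [h]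
  · obtain ⟨l, hl⟩ := Function.ne_iff.mp h
    exact Finset.prod_eq_zero (Finset.mem_univ l) (by simpa using hl)

lemma fCoeff_torusExp {d : ℕ} (j k : Fin d → ℤ) :
    fCoeff (torusExp j) k = if k = j then 1 else 0 := by
  have e : ∀ x : Vd d, torusExp j x * Complex.exp (-(Complex.I * (dotZ k x : ℂ)))
      = torusExp (j - k) x := by
    intro x
    have := torusExp_add (j - k) k x
    rw [sub_add_cancel] at this
    rw [this, mul_assoc, torusExp, torusExp, ← Complex.exp_add]
    simp
  have hpi : ((2 * Real.pi : ℝ) : ℂ) ^ d ≠ 0 := by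
    exact_mod_cast pow_ne_zero d (by positivity : (2 * Real.pi : ℝ) ≠ 0)
  simp_rw [fCoeff, e, integral_box_torusExp, sub_eq_zero, eq_comm (a := k)]
  split_ifs
  · rw [Complex.real_smul]
    push_cast at hpi ⊢
    exact inv_mul_cancel₀ hpi
  · simp

lemma isCompact_box (d : ℕ) : IsCompact (box d) := isCompact_Icc

lemma integrableOn_box_mul_exp {d : ℕ} {f : Vd d → ℂ} (hf : Continuous f) (k : Fin d → ℤ) :
    IntegrableOn (fun x => f x * Complex.exp (-(Complex.I * (dotZ k x : ℂ)))) (box d) := by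
  refine ContinuousOn.integrableOn_compact (isCompact_box d) (Continuous.continuousOn ?_)
  unfold dotZ
  fun_prop

lemma fCoeff_add {d : ℕ} {f g : Vd d → ℂ} (hf : Continuous f) (hg : Continuous g)
    (k : Fin d → ℤ) : fCoeff (fun x => f x + g x) k = fCoeff f k + fCoeff g k := by
  simp only [fCoeff, add_mul]
  rw [integral_add (integrableOn_box_mul_exp hf k) (integrableOn_box_mul_exp hg k), smul_add]

lemma fCoeff_const_mul {d : ℕ} (c : ℂ) (f : Vd d → ℂ) (k : Fin d → ℤ) :
    fCoeff (fun x => c * f x) k = c * fCoeff f k := by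
  simp only [fCoeff, mul_assoc]
  rw [integral_const_mul, mul_smul_comm]

lemma fCoeff_sum {d : ℕ} {ι : Type*} (s : Finset ι) {f : ι → Vd d → ℂ}
    (hf : ∀ i ∈ s, Continuous (f i)) (k : Fin d → ℤ) :
    fCoeff (fun x => ∑ i ∈ s, f i x) k = ∑ i ∈ s, fCoeff (f i) k := by
  simp only [fCoeff, Finset.sum_mul]
  rw [integral_finsetSum s fun i hi => integrableOn_box_mul_exp (hf i hi) k, Finset.smul_sum]

lemma fCoeff_sum_torusExp {d : ℕ} (s : Finset (Fin d → ℤ)) (c : (Fin d → ℤ) → ℂ)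
    (k : Fin d → ℤ) :
    fCoeff (fun x => ∑ j ∈ s, c j * torusExp j x) k = if k ∈ s then c k else 0 := by
  rw [fCoeff_sum s (f := fun j x => c j * torusExp j x)
    fun j _ => continuous_const.mul (contDiff_torusExp j).continuous]
  simp [fCoeff_const_mul, fCoeff_torusExp]

lemma fmul_sum_torusExp {d : ℕ} (m : (Fin d → ℤ) → ℂ) (s : Finset (Fin d → ℤ))
    (c : (Fin d → ℤ) → ℂ) (x : Vd d) :
    fmul m (fun x => ∑ j ∈ s, c j * torusExp j x) x
      = ∑ k ∈ s, m k * c k * torusExp k x := by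
  unfold fmul
  rw [tsum_eq_sum (s := s) fun k hk => by simp [fCoeff_sum_torusExp, hk]]
  refine Finset.sum_congr rfl fun k hk => ?_
  rw [fCoeff_sum_torusExp, if_pos hk]
  rfl

lemma abs_le_eNorm {d : ℕ} (x : Vd d) (i : Fin d) : |x i| ≤ eNorm x := by
  rw [← Real.sqrt_sq_eq_abs]
  exact Real.sqrt_le_sqrt
    (Finset.single_le_sum (f := (x · ^ 2)) (fun _ _ => sq_nonneg _) (Finset.mem_univ i))

lemma eNorm_neg {d : ℕ} (x : Vd d) : eNorm (-x) = eNorm x := by simp [eNorm]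

lemma eNorm_smul {d : ℕ} {t : ℝ} (ht : 0 ≤ t) (x : Vd d) : eNorm (t • x) = t * eNorm x := by
  simp only [eNorm, Pi.smul_apply, smul_eq_mul, mul_pow, ← Finset.mul_sum]
  rw [Real.sqrt_mul (sq_nonneg t), Real.sqrt_sq ht]

lemma eNorm_zero {d : ℕ} : eNorm (0 : Vd d) = 0 := by simp [eNorm]

lemma eNorm_pos {d : ℕ} {x : Vd d} (hx : x ≠ 0) : 0 < eNorm x := by
  obtain ⟨i, hi⟩ := Function.ne_iff.mp hx
  exact (abs_pos.mpr hi).trans_le (abs_le_eNorm x i)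

lemma sq_eNorm {d : ℕ} (x : Vd d) : eNorm x ^ 2 = ∑ i, x i ^ 2 :=
  Real.sq_sqrt (Finset.sum_nonneg fun _ _ => sq_nonneg _)

/-- `χ_λ(k) ≠ 0` for only finitely many `k ∈ ℤ^d` when `χ` is supported in a ball and
vanishes at the origin. -/
lemma finite_dilated_support {d : ℕ} {χ : Vd d → ℝ} {r : ℝ} (hχ : ∀ x, χ x ≠ 0 → eNorm x ≤ r)
    (hχ0 : χ 0 = 0) (lam : ℕ) :
    {k : Fin d → ℤ | χ (fun i => (k i : ℝ) / (lam : ℝ)) ≠ 0}.Finite := by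
  refine (Set.finite_Icc (-fun _ : Fin d => ⌈lam * r⌉) (fun _ => ⌈lam * r⌉)).subset ?_
  intro k hk
  rcases Nat.eq_zero_or_pos lam with rfl | hl
  · exact absurd (by simpa [Pi.zero_def] using hχ0) hk
  · have hl' : (0 : ℝ) < lam := by exact_mod_cast hl
    have key (i : Fin d) : |(k i : ℝ)| ≤ lam * r := by
      have h1 := (abs_le_eNorm _ i).trans (hχ _ hk)
      rw [abs_div, abs_of_pos hl', div_le_iff₀ hl'] at h1
      linarith
    have key2 (i : Fin d) : |k i| ≤ ⌈lam * r⌉ := by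
      have := (key i).trans (Int.le_ceil _)
      exact_mod_cast this
    exact ⟨fun i => (abs_le.mp (key2 i)).1, fun i => (abs_le.mp (key2 i)).2⟩

open scoped SchwartzMap FourierTransform in
/-- Fourier inversion for Schwartz functions, with the `(2π)^{-n}` normalisation. -/
lemma SchwartzMap.integrable_and_inversion_two_pi {V : Type*} [NormedAddCommGroup V]
    [InnerProductSpace ℝ V] [FiniteDimensional ℝ V] [MeasurableSpace V] [BorelSpace V]
    (S : 𝓢(V, ℂ)) {K : V → ℂ}
    (hK : ∀ h, K h = (((2 * Real.pi) ^ Module.finrank ℝ V)⁻¹ : ℝ) •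
      ∫ v, S v * Complex.exp (Complex.I * (inner ℝ v h : ℝ))) :
    Integrable K ∧ ∀ v, ∫ h, K h * Complex.exp (-(Complex.I * (inner ℝ v h : ℝ))) = S v := by
  have hpi : (2 * Real.pi) ≠ 0 := by positivity
  have hK' : ∀ h, K h = (((2 * Real.pi) ^ Module.finrank ℝ V)⁻¹ : ℝ) •
      (𝓕⁻ S) ((2 * Real.pi)⁻¹ • h) := by
    intro h
    rw [hK, SchwartzMap.fourierInv_coe, Real.fourierInv_eq']
    congr 1
    refine integral_congr_ae (.of_forall fun v => ?_)
    simp only [inner_smul_right, smul_eq_mul]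
    rw [mul_inv_cancel_left₀ hpi, mul_comm, mul_comm Complex.I]
  constructor
  · rw [funext hK']
    exact ((𝓕⁻ S).integrable.comp_smul (inv_ne_zero hpi)).smul
      (((2 * Real.pi) ^ Module.finrank ℝ V)⁻¹ : ℝ)
  · intro v
    have h1 : (𝓕 (𝓕⁻ S)) v = S v := by rw [FourierTransform.fourier_fourierInv_eq S]
    simp only [SchwartzMap.fourier_coe, Real.fourier_eq'] at h1
    rw [← h1]
    have h2 := Measure.integral_comp_smul (volume : Measure V)
      (fun w => Complex.exp (((-2 * Real.pi * inner ℝ w v : ℝ) : ℂ) * Complex.I) • (𝓕⁻ S) w)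
      (2 * Real.pi)⁻¹
    rw [inv_pow, inv_inv, abs_of_pos (by positivity)] at h2
    have h3 : ∀ h, K h * Complex.exp (-(Complex.I * (inner ℝ v h : ℝ)))
        = (((2 * Real.pi) ^ Module.finrank ℝ V)⁻¹ : ℝ) •
          (Complex.exp (((-2 * Real.pi * inner ℝ ((2 * Real.pi)⁻¹ • h) v : ℝ) : ℂ) * Complex.I)
            • (𝓕⁻ S) ((2 * Real.pi)⁻¹ • h)) := by
      intro h
      have : -2 * Real.pi * inner ℝ ((2 * Real.pi)⁻¹ • h) v = - inner ℝ v h := by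
        rw [real_inner_smul_left, real_inner_comm]
        field_simp
      rw [hK', this, smul_eq_mul, smul_mul_assoc, mul_comm (Complex.exp _)]
      push_cast
      ring_nf
    simp_rw [h3]
    rw [integral_smul, h2, smul_smul, inv_mul_cancel₀ (by positivity), one_smul]

/-- Fourier inversion on `ℝ^m × ℝ^n` for smooth compactly supported functions. -/
lemma integrable_and_inversion_prod {m n : ℕ} {G : Vd m × Vd n → ℂ}
    (hG : ContDiff ℝ (⊤ : ℕ∞) G) (hGc : HasCompactSupport G) {K : Vd m × Vd n → ℂ}
    (hK : ∀ h, K h = (((2 * Real.pi) ^ (m + n))⁻¹ : ℝ) • ∫ ν : Vd m × Vd n, G ν *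
      Complex.exp (Complex.I * (((∑ l, ν.1 l * h.1 l) + ∑ l, ν.2 l * h.2 l : ℝ) : ℂ))) :
    Integrable K ∧ ∀ ν : Vd m × Vd n, ∫ h : Vd m × Vd n, K h *
      Complex.exp (-(Complex.I * (((∑ l, ν.1 l * h.1 l) + ∑ l, ν.2 l * h.2 l : ℝ) : ℂ)))
        = G ν := by
  let e : EuclideanSpace ℝ (Fin m ⊕ Fin n) ≃L[ℝ] Vd m × Vd n :=
    (EuclideanSpace.equiv (Fin m ⊕ Fin n) ℝ).trans
      (ContinuousLinearEquiv.sumPiEquivProdPi ℝ (Fin m) (Fin n) fun _ => ℝ)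
  have hmp : MeasurePreserving e volume volume :=
    (volume_measurePreserving_sumPiEquivProdPi fun _ : Fin m ⊕ Fin n => ℝ).comp
      (PiLp.volume_preserving_ofLp (Fin m ⊕ Fin n))
  have hme : MeasurableEmbedding e := e.toHomeomorph.measurableEmbedding
  have hinner : ∀ v w : EuclideanSpace ℝ (Fin m ⊕ Fin n), inner ℝ v w
      = (∑ l, (e v).1 l * (e w).1 l) + ∑ l, (e v).2 l * (e w).2 l := by
    intro v w
    rw [EuclideanSpace.inner_eq_star_dotProduct, dotProduct, Fintype.sum_sum_type]
    simp only [star_trivial, mul_comm (w.ofLp _)]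
    rfl
  have hc : HasCompactSupport (G ∘ e) := hGc.comp_homeomorph e.toHomeomorph
  let S := hc.toSchwartzMap (hG.comp e.contDiff)
  have hS : ∀ v, S v = G (e v) := fun v => rfl
  have key := S.integrable_and_inversion_two_pi (K := K ∘ e) (by
    intro h
    rw [finrank_euclideanSpace, Fintype.card_sum, Fintype.card_fin, Fintype.card_fin,
      Function.comp_apply, hK, ← hmp.integral_comp hme]
    simp_rw [hS, hinner])
  refine ⟨(hmp.integrable_comp_emb hme).mp key.1, fun ν => ?_⟩
  have h2 := key.2 (e.symm ν)
  rw [hS, e.apply_symm_apply] at h2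
  rw [← h2, ← hmp.integral_comp hme]
  simp_rw [hinner, e.apply_symm_apply]
  rfl

lemma contDiffAt_eNorm {d : ℕ} {x : Vd d} (hx : x ≠ 0) : ContDiffAt ℝ (⊤ : ℕ∞) eNorm x := by
  have h : ContDiff ℝ (⊤ : ℕ∞) fun x : Vd d => ∑ i, x i ^ 2 :=
    ContDiff.sum (s := Finset.univ) fun i _ => (contDiff_apply ℝ ℝ i).pow 2
  refine h.contDiffAt.sqrt ?_
  rw [← sq_eNorm]
  exact (pow_pos (eNorm_pos hx) 2).ne'

lemma continuous_eNorm {d : ℕ} : Continuous (eNorm : Vd d → ℝ) := by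
  unfold eNorm
  fun_prop

lemma Khat_symm (χ : Vd 2 → ℝ) (lam : ℕ) (ν₁ ν₂ : Vd 2) (i j : Fin 2) :
    Khat χ lam ν₁ ν₂ i j = Khat χ lam ν₂ ν₁ i j := by
  simp only [Khat, mul_comm (eNorm ν₁), add_comm (eNorm ν₁)]
  ring

lemma Khat_comm (χ : Vd 2 → ℝ) (lam : ℕ) (ν₁ ν₂ : Vd 2) (i j : Fin 2) :
    Khat χ lam ν₁ ν₂ i j = Khat χ lam ν₁ ν₂ j i := by
  simp only [Khat, mul_comm (ν₁ i - ν₂ i)]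

lemma Khat_zero_lam {χ : Vd 2 → ℝ} (hχ0 : χ 0 = 0) (ν₁ ν₂ : Vd 2) (i j : Fin 2) :
    Khat χ 0 ν₁ ν₂ i j = 0 := by
  have : χ (fun _ => 0) = 0 := hχ0
  simp [Khat, this]

lemma contDiff_Khat {χ : Vd 2 → ℝ} (hχsm : ContDiff ℝ (⊤ : ℕ∞) χ) {r : ℝ} (hr : 0 < r)
    (hχ : ∀ x, χ x ≠ 0 → r ≤ eNorm x) (lam : ℕ) (i j : Fin 2) :
    ContDiff ℝ (⊤ : ℕ∞) fun ν : Vd 2 × Vd 2 => Khat χ lam ν.1 ν.2 i j := by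
  have hsm : ContDiff ℝ (⊤ : ℕ∞) fun ν : Vd 2 => χ fun l => ν l / (lam : ℝ) :=
    hχsm.comp (contDiff_pi.mpr fun l => (contDiff_apply ℝ ℝ l).div_const _)
  have hzero : ∀ᶠ ν : Vd 2 in nhds 0, χ (fun l => ν l / (lam : ℝ)) = 0 := by
    have hc : Continuous fun ν : Vd 2 => eNorm (fun l => ν l / (lam : ℝ)) :=
      continuous_eNorm.comp (by fun_prop)
    have h0 : eNorm (fun l => (0 : Vd 2) l / (lam : ℝ)) < r := by
      simpa [eNorm] using hr
    filter_upwards [hc.continuousAt.eventually_lt continuousAt_const h0] with ν hν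
    by_contra h
    exact (hχ _ h).not_gt hν
  rw [contDiff_iff_contDiffAt]
  rintro ⟨ν₁, ν₂⟩
  have hzero_at (f : Vd 2 × Vd 2 → ℝ) (h : f =ᶠ[nhds (ν₁, ν₂)] fun _ => 0) :
      ContDiffAt ℝ (⊤ : ℕ∞) f (ν₁, ν₂) := contDiffAt_const.congr_of_eventuallyEq h
  rcases eq_or_ne ν₁ 0 with rfl | h1
  · refine hzero_at _ ?_
    filter_upwards [continuousAt_fst.eventually hzero] with ν hν
    simp [Khat, hν]
  rcases eq_or_ne ν₂ 0 with rfl | h2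
  · refine hzero_at _ ?_
    filter_upwards [continuousAt_snd.eventually hzero] with ν hν
    simp [Khat, hν]
  have e1 : ContDiffAt ℝ (⊤ : ℕ∞) (fun ν : Vd 2 × Vd 2 => eNorm ν.1) (ν₁, ν₂) :=
    ContDiffAt.comp (g := eNorm) (ν₁, ν₂) (contDiffAt_eNorm h1) contDiffAt_fst
  have e2 : ContDiffAt ℝ (⊤ : ℕ∞) (fun ν : Vd 2 × Vd 2 => eNorm ν.2) (ν₁, ν₂) :=
    ContDiffAt.comp (g := eNorm) (ν₁, ν₂) (contDiffAt_eNorm h2) contDiffAt_snd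
  have c1 (l : Fin 2) : ContDiffAt ℝ (⊤ : ℕ∞) (fun ν : Vd 2 × Vd 2 => ν.1 l - ν.2 l) (ν₁, ν₂) :=
    (((contDiff_apply ℝ ℝ l).comp contDiff_fst).sub
      ((contDiff_apply ℝ ℝ l).comp contDiff_snd)).contDiffAt
  have hpos1 := eNorm_pos h1
  have hpos2 := eNorm_pos h2
  unfold Khat
  refine ((ContDiffAt.div (contDiffAt_const.mul ((c1 i).mul (c1 j)))
    ((e1.mul e2).mul (e1.add e2)) (by positivity)).mul
    (hsm.comp contDiff_fst).contDiffAt).mul (hsm.comp contDiff_snd).contDiffAt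

lemma hasCompactSupport_Khat {χ : Vd 2 → ℝ} {r : ℝ} (hχ : ∀ x, χ x ≠ 0 → eNorm x ≤ r)
    (hχ0 : χ 0 = 0) (lam : ℕ) (i j : Fin 2) :
    HasCompactSupport fun ν : Vd 2 × Vd 2 => Khat χ lam ν.1 ν.2 i j := by
  rcases Nat.eq_zero_or_pos lam with rfl | hl
  · simp_rw [Khat_zero_lam hχ0]
    exact HasCompactSupport.zero
  have hl' : (0 : ℝ) < lam := by exact_mod_cast hl
  refine HasCompactSupport.intro (K := Set.Icc (-fun _ => lam * r) (fun _ => lam * r) ×ˢ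
    Set.Icc (-fun _ => lam * r) (fun _ => lam * r)) (isCompact_Icc.prod isCompact_Icc) ?_
  intro ν hν
  have key (x : Vd 2) (hx : χ (fun l => x l / (lam : ℝ)) ≠ 0) :
      x ∈ Set.Icc (-fun _ => lam * r) (fun _ => lam * r) := by
    have hb (l : Fin 2) : |x l| ≤ lam * r := by
      have h1 := (abs_le_eNorm _ l).trans (hχ _ hx)
      rw [abs_div, abs_of_pos hl', div_le_iff₀ hl'] at h1
      linarith
    exact ⟨fun l => (abs_le.mp (hb l)).1, fun l => (abs_le.mp (hb l)).2⟩
  by_contra h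
  refine hν ⟨key _ fun h0 => h ?_, key _ fun h0 => h ?_⟩ <;> simp [Khat, h0]

lemma integrable_and_inversion_Kker {χ : Vd 2 → ℝ} (hχsm : ContDiff ℝ (⊤ : ℕ∞) χ) {r r' : ℝ}
    (hr : 0 < r) (hχ : ∀ x, χ x ≠ 0 → r ≤ eNorm x ∧ eNorm x ≤ r') (lam : ℕ) (i j : Fin 2) :
    Integrable (fun h : Vd 2 × Vd 2 => Kker χ lam h i j) ∧
    ∀ ν : Vd 2 × Vd 2, ∫ h : Vd 2 × Vd 2, Kker χ lam h i j *
      Complex.exp (-(Complex.I * (((∑ l, ν.1 l * h.1 l) + ∑ l, ν.2 l * h.2 l : ℝ) : ℂ)))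
        = (Khat χ lam ν.1 ν.2 i j : ℂ) := by
  have hχ0 : χ 0 = 0 := by
    by_contra h
    have := (hχ 0 h).1
    rw [eNorm_zero] at this
    linarith
  refine integrable_and_inversion_prod (G := fun ν => (Khat χ lam ν.1 ν.2 i j : ℂ))
    (Complex.ofRealCLM.contDiff.comp (contDiff_Khat hχsm hr (fun x hx => (hχ x hx).1) lam i j))
    ((hasCompactSupport_Khat (fun x hx => (hχ x hx).2) hχ0 lam i j).comp_left
      (g := Complex.ofReal) Complex.ofReal_zero) ?_
  intro h
  simp only [Kker, Complex.ofReal_mul, mul_assoc]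
  rw [integral_const_mul, mul_inv, mul_smul]
  simp only [Complex.real_smul]
  push_cast
  ring

/-- The covering map `ℝ^d → (ℝ/ℤ)^d`, `x ↦ x/(2π)`. -/
def toUnitTorus {d : ℕ} : Vd d → UnitAddTorus (Fin d) :=
  Pi.map fun _ (y : ℝ) => ((y * (2 * Real.pi)⁻¹ : ℝ) : UnitAddCircle)

lemma continuous_toUnitTorus {d : ℕ} : Continuous (toUnitTorus (d := d)) :=
  Continuous.piMap fun _ => (AddCircle.continuous_mk' 1).comp (continuous_mul_const _)

lemma isQuotientMap_toUnitTorus {d : ℕ} : Topology.IsQuotientMap (toUnitTorus (d := d)) := by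
  have hpi : (2 * Real.pi)⁻¹ ≠ 0 := by positivity
  have hs : Function.Surjective fun y : ℝ => ((y * (2 * Real.pi)⁻¹ : ℝ) : UnitAddCircle) :=
    QuotientAddGroup.mk_surjective.comp (mul_right_surjective₀ hpi)
  have ho : IsOpenMap fun y : ℝ => ((y * (2 * Real.pi)⁻¹ : ℝ) : UnitAddCircle) :=
    QuotientAddGroup.isOpenMap_coe.comp (Homeomorph.mulRight₀ _ hpi).isOpenMap
  exact (IsOpenMap.piMap (fun _ => ho) (.of_forall fun _ => hs)).isQuotientMap
    continuous_toUnitTorus (Function.Surjective.piMap fun _ => hs)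

lemma TorusFun.exists_lift {d : ℕ} {F : Type*} [TopologicalSpace F] {f : Vd d → F}
    (hf : TorusFun f) (hc : Continuous f) :
    ∃ g : C(UnitAddTorus (Fin d), F), ∀ x, g (toUnitTorus x) = f x := by
  have hq : Topology.IsQuotientMap
      (⟨toUnitTorus, continuous_toUnitTorus⟩ : C(Vd d, UnitAddTorus (Fin d))) :=
    isQuotientMap_toUnitTorus
  have hfac : Function.FactorsThrough (⟨f, hc⟩ : C(Vd d, F))
      (⟨toUnitTorus, continuous_toUnitTorus⟩ : C(Vd d, UnitAddTorus (Fin d))) := by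
    intro x y hxy
    have h (i : Fin d) : ∃ n : ℤ, x i = y i + 2 * Real.pi * n := by
      have h1 : ((x i * (2 * Real.pi)⁻¹ - y i * (2 * Real.pi)⁻¹ : ℝ) : UnitAddCircle) = 0 := by
        rw [AddCircle.coe_sub, sub_eq_zero]
        exact congrFun hxy i
      obtain ⟨n, hn⟩ := (AddCircle.coe_eq_zero_iff 1).mp h1
      refine ⟨n, ?_⟩
      have hpi : 2 * Real.pi ≠ 0 := by positivity
      rw [zsmul_one] at hn
      field_simp at hn
      linarith
    choose m hm using h
    have : x = y + latt m := funext hm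
    exact this ▸ hf y m
  exact ⟨hq.lift ⟨f, hc⟩ hfac, fun x => congrArg (· x) (hq.lift_comp ⟨f, hc⟩ hfac)⟩

lemma mFourier_toUnitTorus {d : ℕ} (k : Fin d → ℤ) (x : Vd d) :
    UnitAddTorus.mFourier k (toUnitTorus x) = torusExp k x := by
  rw [UnitAddTorus.mFourier, ContinuousMap.coe_mk, torusExp, dotZ, Complex.ofReal_sum,
    Finset.mul_sum, Complex.exp_sum]
  refine Finset.prod_congr rfl fun i _ => ?_
  rw [toUnitTorus, Pi.map_apply, fourier_coe_apply]
  congr 1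
  push_cast
  have hpi : (Real.pi : ℂ) ≠ 0 := by exact_mod_cast Real.pi_ne_zero
  field_simp

/-- Integration of `f ∘ p` against an integrable density, as a continuous functional of `f`. -/
def integralCompCLM {α T : Type*} [TopologicalSpace T] [CompactSpace T]
    [TopologicalSpace α] [SecondCountableTopology α] [MeasurableSpace α] [OpensMeasurableSpace α]
    {μ : Measure α} {φ : α → ℂ} (hφ : Integrable φ μ) {p : α → T} (hp : Continuous p) :
    C(T, ℂ) →L[ℂ] ℂ :=
  have hint (f : C(T, ℂ)) : Integrable (fun h => f (p h) * φ h) μ :=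
    hφ.bdd_mul (f.continuous.comp hp).aestronglyMeasurable
      (.of_forall fun h => f.norm_coe_le_norm (p h))
  LinearMap.mkContinuous
    { toFun := fun f => ∫ h, f (p h) * φ h ∂μ
      map_add' := fun f g => by
        rw [← integral_add (hint f) (hint g)]
        simp [add_mul]
      map_smul' := fun c f => by
        rw [RingHom.id_apply, smul_eq_mul, ← integral_const_mul]
        simp [mul_assoc] }
    (∫ h, ‖φ h‖ ∂μ) fun f => by
      rw [mul_comm, ← integral_const_mul]
      refine norm_integral_le_of_norm_le (hφ.norm.const_mul _) (.of_forall fun h => ?_)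
      rw [norm_mul]
      exact mul_le_mul_of_nonneg_right (f.norm_coe_le_norm (p h)) (norm_nonneg _)

lemma integralCompCLM_apply {α T : Type*} [TopologicalSpace T] [CompactSpace T]
    [TopologicalSpace α] [SecondCountableTopology α] [MeasurableSpace α] [OpensMeasurableSpace α]
    {μ : Measure α} {φ : α → ℂ} (hφ : Integrable φ μ) {p : α → T} (hp : Continuous p)
    (f : C(T, ℂ)) : integralCompCLM hφ hp f = ∫ h, f (p h) * φ h ∂μ := rfl

/-- The Fourier coefficient as a continuous functional on `C(𝕋^d)`. -/
lemma exists_fCoeffCLM {d : ℕ} (k : Fin d → ℤ) :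
    ∃ L : C(UnitAddTorus (Fin d), ℂ) →L[ℂ] ℂ, ∀ f, L f = fCoeff (fun x => f (toUnitTorus x)) k := by
  have hi := integrableOn_box_mul_exp (d := d) (f := fun _ => 1) continuous_const k
  refine ⟨((((2 * Real.pi) ^ d)⁻¹ : ℝ) : ℂ) • integralCompCLM hi continuous_toUnitTorus,
    fun f => ?_⟩
  simp [integralCompCLM_apply, fCoeff]

lemma ContinuousLinearMap.ext_mFourier {d : ℕ} {L M : C(UnitAddTorus (Fin d), ℂ) →L[ℂ] ℂ}
    (h : ∀ k, L (UnitAddTorus.mFourier k) = M (UnitAddTorus.mFourier k)) : L = M := by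
  refine ContinuousLinearMap.ext_on
    (Submodule.dense_iff_topologicalClosure_eq_top.mpr UnitAddTorus.span_mFourier_closure_eq_top) ?_
  rintro _ ⟨k, rfl⟩
  exact h k

/-- A bilinear Fourier multiplier with finitely many nonzero symbol values, written as an
integral against its physical-space kernel. -/
lemma bilinear_multiplier_eq_integral {d : ℕ} {G : Vd d → Vd d → ℂ} {K : Vd d × Vd d → ℂ}
    (hK : Integrable K)
    (hG : ∀ ν : Vd d × Vd d, ∫ h : Vd d × Vd d, K h *
      Complex.exp (-(Complex.I * (((∑ l, ν.1 l * h.1 l) + ∑ l, ν.2 l * h.2 l : ℝ) : ℂ)))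
        = G ν.1 ν.2)
    (s : Finset (Fin d → ℤ))
    (hs : ∀ j k : Fin d → ℤ, (j ∉ s ∨ k ∉ s) → G (fun l => j l) (fun l => k l) = 0)
    {f g : Vd d → ℂ} (hf : Continuous f) (hg : Continuous g) (hfp : TorusFun f)
    (hgp : TorusFun g) (x : Vd d) :
    ∑ j ∈ s, ∑ k ∈ s, G (fun l => j l) (fun l => k l) * fCoeff f j * fCoeff g k
        * torusExp (j + k) x
      = ∫ h : Vd d × Vd d, f (x - h.1) * g (x - h.2) * K h := by
  obtain ⟨F, hF⟩ := hfp.exists_lift hf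
  obtain ⟨H, hH⟩ := hgp.exists_lift hg
  obtain rfl : (fun y => F (toUnitTorus y)) = f := funext hF
  obtain rfl : (fun y => H (toUnitTorus y)) = g := funext hH
  clear hF hH hf hg hfp hgp
  choose c hc using fun k : Fin d → ℤ => exists_fCoeffCLM k
  have hp1 : Continuous fun h : Vd d × Vd d => toUnitTorus (x - h.1) :=
    continuous_toUnitTorus.comp (by fun_prop)
  have hp2 : Continuous fun h : Vd d × Vd d => toUnitTorus (x - h.2) :=
    continuous_toUnitTorus.comp (by fun_prop)
  have hint (p : Vd d × Vd d → UnitAddTorus (Fin d)) (hp : Continuous p)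
      (F : C(UnitAddTorus (Fin d), ℂ)) : Integrable fun h => F (p h) * K h :=
    hK.bdd_mul (F.continuous.comp hp).aestronglyMeasurable
      (.of_forall fun h => F.norm_coe_le_norm _)
  have hcexp (m k : Fin d → ℤ) : c k (UnitAddTorus.mFourier m) = if k = m then 1 else 0 := by
    rw [hc, ← fCoeff_torusExp]
    simp_rw [mFourier_toUnitTorus]
  have hexp (k : Fin d → ℤ) (y : Vd d) :
      torusExp k (x - y) = torusExp k x * Complex.exp (-(Complex.I * (dotZ k y : ℂ))) := by
    rw [torusExp, torusExp, ← Complex.exp_add]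
    congr 1
    simp only [dotZ, Pi.sub_apply, mul_sub, Finset.sum_sub_distrib]
    push_cast
    ring
  have hmodes (m n : Fin d → ℤ) :
      ∑ j ∈ s, ∑ k ∈ s, G (fun l => j l) (fun l => k l) * c j (UnitAddTorus.mFourier m)
        * c k (UnitAddTorus.mFourier n) * torusExp (j + k) x
      = ∫ h : Vd d × Vd d, UnitAddTorus.mFourier m (toUnitTorus (x - h.1))
          * UnitAddTorus.mFourier n (toUnitTorus (x - h.2)) * K h := by
    have hl : ∑ j ∈ s, ∑ k ∈ s, G (fun l => j l) (fun l => k l) * c j (UnitAddTorus.mFourier m)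
        * c k (UnitAddTorus.mFourier n) * torusExp (j + k) x
        = G (fun l => m l) (fun l => n l) * torusExp (m + n) x := by
      simp only [hcexp, mul_ite, ite_mul, mul_one, mul_zero, zero_mul]
      by_cases hm : m ∈ s <;> by_cases hn : n ∈ s <;> simp [hm, hn, hs m n]
    have hr (h : Vd d × Vd d) : UnitAddTorus.mFourier m (toUnitTorus (x - h.1))
          * UnitAddTorus.mFourier n (toUnitTorus (x - h.2)) * K h
        = torusExp (m + n) x * (K h * Complex.exp (-(Complex.I *
          (((∑ l, (m l : ℝ) * h.1 l) + ∑ l, (n l : ℝ) * h.2 l : ℝ) : ℂ)))) := by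
      rw [mFourier_toUnitTorus, mFourier_toUnitTorus, hexp, hexp, torusExp_add,
        Complex.ofReal_add, mul_add, neg_add, Complex.exp_add]
      simp only [dotZ]
      ring
    simp_rw [hl, hr]
    rw [integral_const_mul, hG (fun l => m l, fun l => n l), mul_comm]
  have hstep (F : C(UnitAddTorus (Fin d), ℂ)) (n : Fin d → ℤ) :
      ∑ j ∈ s, ∑ k ∈ s, G (fun l => j l) (fun l => k l) * c j F
        * c k (UnitAddTorus.mFourier n) * torusExp (j + k) x
      = ∫ h : Vd d × Vd d, F (toUnitTorus (x - h.1))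
          * UnitAddTorus.mFourier n (toUnitTorus (x - h.2)) * K h := by
    have := ContinuousLinearMap.ext_mFourier
      (L := ∑ j ∈ s, ∑ k ∈ s, (G (fun l => j l) (fun l => k l)
        * c k (UnitAddTorus.mFourier n) * torusExp (j + k) x) • c j)
      (M := integralCompCLM (hint _ hp2 (UnitAddTorus.mFourier n)) hp1) fun m => by
        simpa [integralCompCLM_apply, mul_assoc, mul_left_comm, mul_comm] using hmodes m n
    simpa [integralCompCLM_apply, mul_assoc, mul_left_comm, mul_comm] using congrArg (· F) this
  have := ContinuousLinearMap.ext_mFourier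
    (L := ∑ j ∈ s, ∑ k ∈ s, (G (fun l => j l) (fun l => k l) * c j F * torusExp (j + k) x) • c k)
    (M := integralCompCLM (hint _ hp1 F) hp2) fun n => by
      simpa [integralCompCLM_apply, mul_assoc, mul_left_comm, mul_comm] using hstep F n
  simpa [integralCompCLM_apply, hc, mul_assoc, mul_left_comm, mul_comm] using congrArg (· H) this

lemma perpDivDiv_sum_torusExp {ι : Type*} (s : Finset ι) (c : ι → Fin 2 → Fin 2 → ℂ)
    (q : ι → Fin 2 → ℤ) (x : Vd 2) :
    perpDivDiv (fun y i i' => ∑ p ∈ s, c p i i' * torusExp (q p) y) x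
      = ∑ p ∈ s, (((q p 1 : ℂ) * ∑ j, c p 0 j * (q p j : ℂ))
          - (q p 0 : ℂ) * ∑ j, c p 1 j * (q p j : ℂ)) * torusExp (q p) x := by
  simp only [perpDivDiv, pd_sum_torusExp, Fin.sum_univ_two, ← Finset.sum_add_distrib, ← add_mul,
    ← Finset.sum_neg_distrib]
  refine Finset.sum_congr rfl fun p _ => ?_
  linear_combination ((c p 0 0 * q p 0 + c p 0 1 * q p 1) * q p 1
    - (c p 1 0 * q p 0 + c p 1 1 * q p 1) * q p 0) * torusExp (q p) x * (- Complex.I_sq)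

lemma Pproj_eq_sum {χ : Vd 2 → ℝ} {lam : ℕ} {s : Finset (Fin 2 → ℤ)}
    (hs : ∀ k ∉ s, χ (fun i => (k i : ℝ) / (lam : ℝ)) = 0) (f : Vd 2 → ℂ) :
    Pproj χ lam f = fun x => ∑ k ∈ s,
      ((χ (fun i => (k i : ℝ) / (lam : ℝ)) : ℂ) * fCoeff f k) * torusExp k x := by
  funext x
  exact tsum_eq_sum fun k hk => by simp [hs k hk]

lemma Khat_eq_zero {χ : Vd 2 → ℝ} {lam : ℕ} {s : Finset (Fin 2 → ℤ)}
    (hs : ∀ k ∉ s, χ (fun i => (k i : ℝ) / (lam : ℝ)) = 0) {j k : Fin 2 → ℤ}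
    (h : j ∉ s ∨ k ∉ s) (i i' : Fin 2) :
    Khat χ lam (fun l => j l) (fun l => k l) i i' = 0 := by
  rcases h with h | h <;> simp [Khat, hs _ h]

lemma tsum_Khat_eq_sum {χ : Vd 2 → ℝ} {lam : ℕ} {s : Finset (Fin 2 → ℤ)}
    (hs : ∀ k ∉ s, χ (fun i => (k i : ℝ) / (lam : ℝ)) = 0) (i i' : Fin 2)
    (c d : (Fin 2 → ℤ) → ℂ) (x : Vd 2) :
    ∑' jk : (Fin 2 → ℤ) × (Fin 2 → ℤ),
        ((16 * Khat χ lam (fun l => (jk.1 l : ℝ)) (fun l => (jk.2 l : ℝ)) i i' : ℝ) : ℂ)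
          * c jk.2 * d jk.1 * Complex.exp (Complex.I * (dotZ (jk.1 + jk.2) x : ℂ))
      = 16 * ∑ jk ∈ s ×ˢ s, (Khat χ lam (fun l => (jk.1 l : ℝ)) (fun l => (jk.2 l : ℝ)) i i' : ℂ)
          * c jk.2 * d jk.1 * torusExp (jk.1 + jk.2) x := by
  rw [tsum_eq_sum (s := s ×ˢ s), Finset.mul_sum]
  · refine Finset.sum_congr rfl fun p _ => ?_
    rw [torusExp]
    push_cast
    ring
  · intro jk hjk
    have : jk.1 ∉ s ∨ jk.2 ∉ s := by
      rw [Finset.mem_product] at hjk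
      tauto
    simp [Khat_eq_zero hs this]

lemma Bfield_eq_sum {χ : Vd 2 → ℝ} {lam : ℕ} {s : Finset (Fin 2 → ℤ)}
    (hs : ∀ k ∉ s, χ (fun i => (k i : ℝ) / (lam : ℝ)) = 0) (a : Vd 2 → ℝ) (Φ : Vd 2 → Vd 2)
    (ξ : Fin 2 → ℤ) (x : Vd 2) (i i' : Fin 2) :
    Bfield χ a Φ lam ξ x i i' = ∑ jk ∈ s ×ˢ s,
      ((Khat χ lam (fun l => (jk.1 l : ℝ)) (fun l => (jk.2 l : ℝ)) i i' : ℂ)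
        * (∑ η ∈ ({ξ, -ξ} : Finset (Fin 2 → ℤ)), fCoeff (Thp a Φ lam η) jk.2)
        * (∑ ζ ∈ ({ξ, -ξ} : Finset (Fin 2 → ℤ)), fCoeff (Thp a Φ lam ζ) jk.1))
        * torusExp (jk.1 + jk.2) x := by
  simp_rw [Bfield, tsum_Khat_eq_sum hs, ← Finset.mul_sum]
  rw [← mul_assoc, show (1 / 16 : ℂ) * 16 = 1 by norm_num, one_mul]
  simp_rw [Finset.mul_sum, Finset.sum_mul]
  rw [Finset.sum_comm, Finset.sum_comm (s := s ×ˢ s)]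
  exact Finset.sum_congr rfl fun _ _ => Finset.sum_comm

lemma continuous_Thp {a : Vd 2 → ℝ} (ha : Continuous a) {Φ : Vd 2 → Vd 2} (hΦ : Continuous Φ)
    (lam : ℕ) (η : Fin 2 → ℤ) : Continuous (Thp a Φ lam η) := by
  unfold Thp
  fun_prop

lemma torusFun_Thp {a : Vd 2 → ℝ} (ha : TorusFun a) {Φ : Vd 2 → Vd 2}
    (hΦ : ∀ (x : Vd 2) (m : Fin 2 → ℤ), Φ (x + latt m) = Φ x + latt m)
    (lam : ℕ) (η : Fin 2 → ℤ) : TorusFun (Thp a Φ lam η) := by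
  intro x m
  have h : Complex.I * (((lam : ℝ) * ∑ j, (Φ x + latt m) j * (η j : ℝ) : ℝ) : ℂ)
      = Complex.I * (((lam : ℝ) * ∑ j, Φ x j * (η j : ℝ) : ℝ) : ℂ)
        + ((lam * ∑ j, m j * η j : ℤ) : ℂ) * (2 * Real.pi * Complex.I) := by
    simp only [Pi.add_apply, latt, Fin.sum_univ_two]
    push_cast
    ring
  rw [Thp, Thp, ha, hΦ, h, Complex.exp_add, Complex.exp_int_mul_two_pi_mul_I, mul_one]

lemma fCoeff_mul_cos {a : Vd 2 → ℝ} (ha : Continuous a) {Φ : Vd 2 → Vd 2} (hΦ : Continuous Φ)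
    (lam : ℕ) {ξ : Fin 2 → ℤ} (hξ : ξ ≠ 0) (k : Fin 2 → ℤ) :
    fCoeff (fun x => ((a x * Real.cos ((lam : ℝ) * ∑ j, Φ x j * (ξ j : ℝ)) : ℝ) : ℂ)) k
      = 1 / 2 * ∑ η ∈ ({ξ, -ξ} : Finset (Fin 2 → ℤ)), fCoeff (Thp a Φ lam η) k := by
  rw [Finset.sum_pair (neg_ne_self.mpr hξ).symm, ← fCoeff_add (continuous_Thp ha hΦ lam _)
    (continuous_Thp ha hΦ lam _), ← fCoeff_const_mul]
  congr 1
  funext x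
  simp only [Thp, Pi.neg_apply, Int.cast_neg, mul_neg, Finset.sum_neg_distrib]
  rw [Complex.ofReal_mul, Complex.ofReal_cos, Complex.cos]
  push_cast
  ring_nf

/-- The symbol identity behind `∇^⊥Λ^{-1}θ · ∇θ = ∇^⊥·div B`, symmetrised in the two
frequencies. -/
lemma sqg_symbol_identity {j k : Fin 2 → ℤ} (hj : j ≠ 0) (hk : k ≠ 0) (χ : Vd 2 → ℝ) (lam : ℕ) :
    ((((j + k) 1 : ℤ) : ℂ) * ∑ l, (Khat χ lam (fun l => (j l : ℝ)) (fun l => (k l : ℝ)) 0 l : ℂ)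
        * (((j + k) l : ℤ) : ℂ)
      - (((j + k) 0 : ℤ) : ℂ) * ∑ l, (Khat χ lam (fun l => (j l : ℝ)) (fun l => (k l : ℝ)) 1 l : ℂ)
        * (((j + k) l : ℤ) : ℂ))
    = 1 / 8 * (((k 1 : ℂ) * j 0 - k 0 * j 1) / (kAbs k : ℂ)
        + ((j 1 : ℂ) * k 0 - j 0 * k 1) / (kAbs j : ℂ))
      * (χ fun l => (j l : ℝ) / (lam : ℝ) : ℝ) * (χ fun l => (k l : ℝ) / (lam : ℝ) : ℝ) := by
  have hne {m : Fin 2 → ℤ} (hm : m ≠ 0) : (fun l => (m l : ℝ)) ≠ 0 := fun h =>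
    hm (funext fun l => by simpa using congrFun h l)
  have hJ : 0 < kAbs j := eNorm_pos (hne hj)
  have hK : 0 < kAbs k := eNorm_pos (hne hk)
  have hJ2 : (kAbs j : ℂ) ^ 2 = (j 0 : ℂ) ^ 2 + (j 1 : ℂ) ^ 2 := by
    rw [kAbs, ← Complex.ofReal_pow, sq_eNorm, Fin.sum_univ_two]
    push_cast
    rfl
  have hK2 : (kAbs k : ℂ) ^ 2 = (k 0 : ℂ) ^ 2 + (k 1 : ℂ) ^ 2 := by
    rw [kAbs, ← Complex.ofReal_pow, sq_eNorm, Fin.sum_univ_two]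
    push_cast
    rfl
  have hJ' : (kAbs j : ℂ) ≠ 0 := by exact_mod_cast hJ.ne'
  have hK' : (kAbs k : ℂ) ≠ 0 := by exact_mod_cast hK.ne'
  have hJK : (kAbs j : ℂ) + kAbs k ≠ 0 := by exact_mod_cast (add_pos hJ hK).ne'
  simp only [Fin.sum_univ_two, Khat, Pi.add_apply, ← kAbs.eq_1]
  push_cast
  field_simp
  linear_combination (16 * (χ fun l => (j l : ℝ) / (lam : ℝ) : ℝ)
    * (χ fun l => (k l : ℝ) / (lam : ℝ) : ℝ) * ((k 1 : ℂ) * j 0 - k 0 * j 1)) * (hK2 - hJ2)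

lemma sum_sqgOp_mul_pd {s : Finset (Fin 2 → ℤ)} (hs : 0 ∉ s) (c : (Fin 2 → ℤ) → ℂ) (x : Vd 2) :
    ∑ i, sqgOp i (fun y => ∑ k ∈ s, c k * torusExp k y) x
        * pd i (fun y => ∑ k ∈ s, c k * torusExp k y) x
      = ∑ jk ∈ s ×ˢ s, ((jk.2 1 : ℂ) * jk.1 0 - jk.2 0 * jk.1 1) / (kAbs jk.2 : ℂ)
          * c jk.1 * c jk.2 * torusExp (jk.1 + jk.2) x := by
  have h (i : Fin 2) := pd_sum_torusExp s c id i
  simp only [id] at h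
  simp only [sqgOp, fmul_sum_torusExp, h, Fin.sum_univ_two, Finset.sum_mul_sum]
  rw [← Finset.sum_add_distrib, Finset.sum_product_right]
  refine Finset.sum_congr rfl fun k hk => ?_
  rw [← Finset.sum_add_distrib]
  refine Finset.sum_congr rfl fun j _ => ?_
  have hk0 : k ≠ 0 := fun h0 => hs (h0 ▸ hk)
  simp only [hk0, if_false, if_true, one_ne_zero, torusExp_add]
  linear_combination (((k 0 : ℂ) * j 1 - k 1 * j 0) / (kAbs k : ℂ) * c j * c k
    * torusExp j x * torusExp k x) * Complex.I_sq

lemma sum_product_symmetrize {ι : Type*} (s : Finset ι) (F : ι → ι → ℂ) :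
    ∑ p ∈ s ×ˢ s, 1 / 2 * (F p.1 p.2 + F p.2 p.1) = ∑ p ∈ s ×ˢ s, F p.1 p.2 := by
  have : ∑ p ∈ s ×ˢ s, F p.2 p.1 = ∑ p ∈ s ×ˢ s, F p.1 p.2 := by
    rw [Finset.sum_product, Finset.sum_product_right]
  rw [← Finset.mul_sum, Finset.sum_add_distrib, this]
  ring

lemma sqg_nonlinearity_eq_perpDivDiv {χ : Vd 2 → ℝ} {lam : ℕ} {s : Finset (Fin 2 → ℤ)}
    (hs : ∀ k ∉ s, χ (fun i => (k i : ℝ) / (lam : ℝ)) = 0) (hs0 : 0 ∉ s)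
    {a : Vd 2 → ℝ} (ha : Continuous a) {Φ : Vd 2 → Vd 2} (hΦ : Continuous Φ)
    {ξ : Fin 2 → ℤ} (hξ : ξ ≠ 0) {θ : Vd 2 → ℂ}
    (hθ : θ = Pproj χ lam
      (fun x => ((a x * Real.cos ((lam : ℝ) * ∑ j, Φ x j * (ξ j : ℝ)) : ℝ) : ℂ)))
    (x : Vd 2) :
    ∑ i, sqgOp i θ x * pd i θ x
      = perpDivDiv (fun y i i' => Bfield χ a Φ lam ξ y i i') x := by
  obtain ⟨A, hA⟩ : ∃ A : (Fin 2 → ℤ) → ℂ,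
      ∀ k, ∑ η ∈ ({ξ, -ξ} : Finset (Fin 2 → ℤ)), fCoeff (Thp a Φ lam η) k = A k :=
    ⟨_, fun _ => rfl⟩
  simp_rw [hθ, Pproj_eq_sum hs, fCoeff_mul_cos ha hΦ lam hξ, Bfield_eq_sum hs, hA]
  rw [sum_sqgOp_mul_pd hs0, perpDivDiv_sum_torusExp (s ×ˢ s)
    (fun jk i i' => (Khat χ lam (fun l => (jk.1 l : ℝ)) (fun l => (jk.2 l : ℝ)) i i' : ℂ)
        * A jk.2 * A jk.1)
    (fun jk => jk.1 + jk.2)]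
  rw [← sum_product_symmetrize s fun j k => ((k 1 : ℂ) * j 0 - k 0 * j 1) / (kAbs k : ℂ)
    * ((χ (fun i => (j i : ℝ) / (lam : ℝ)) : ℂ) * (1 / 2 * A j))
    * ((χ (fun i => (k i : ℝ) / (lam : ℝ)) : ℂ) * (1 / 2 * A k)) * torusExp (j + k) x]
  refine Finset.sum_congr rfl fun p hp => ?_
  rw [Finset.mem_product] at hp
  have hj : p.1 ≠ 0 := fun h0 => hs0 (h0 ▸ hp.1)
  have hk : p.2 ≠ 0 := fun h0 => hs0 (h0 ▸ hp.2)
  have key := sqg_symbol_identity hj hk χ lam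
  simp only [Fin.sum_univ_two] at key ⊢
  rw [add_comm p.2 p.1]
  linear_combination (-(A p.1) * A p.2 * torusExp (p.1 + p.2) x) * key

lemma contDiff_Bfield {χ : Vd 2 → ℝ} {lam : ℕ} {s : Finset (Fin 2 → ℤ)}
    (hs : ∀ k ∉ s, χ (fun i => (k i : ℝ) / (lam : ℝ)) = 0) (a : Vd 2 → ℝ) (Φ : Vd 2 → Vd 2)
    (ξ : Fin 2 → ℤ) :
    ContDiff ℝ (⊤ : ℕ∞) (fun x => (fun i i' => Bfield χ a Φ lam ξ x i i' :
        Fin 2 → Fin 2 → ℂ)) := by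
  refine contDiff_pi.mpr fun i => contDiff_pi.mpr fun i' => ?_
  simp_rw [Bfield_eq_sum hs]
  exact ContDiff.sum fun p _ => contDiff_const.mul (contDiff_torusExp _)

lemma Bfield_comm (χ a : Vd 2 → ℝ) (Φ : Vd 2 → Vd 2) (lam : ℕ) (ξ : Fin 2 → ℤ) (x : Vd 2)
    (i i' : Fin 2) : Bfield χ a Φ lam ξ x i i' = Bfield χ a Φ lam ξ x i' i := by
  simp only [Bfield, Khat_comm χ lam _ _ i i']

lemma gradT_neg (Φ : Vd 2 → Vd 2) (ξ : Fin 2 → ℤ) (x : Vd 2) :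
    gradT Φ (-ξ) x = -gradT Φ ξ x := by
  funext i
  simp [gradT]

lemma Khat_self (χ : Vd 2 → ℝ) (lam : ℕ) (ν : Vd 2) (i j : Fin 2) :
    Khat χ lam ν ν i j = 0 := by
  simp [Khat]

lemma Khat_smul_neg {χ : Vd 2 → ℝ} {g : Vd 2} (hg : g ≠ 0) (h1 : χ g = 1) (h2 : χ (-g) = 1)
    (hχ0 : χ 0 = 0) (lam : ℕ) (i j : Fin 2) :
    Khat χ lam ((lam : ℝ) • g) ((lam : ℝ) • -g) i j
      = 1 / 8 * (g i * g j) / ((lam : ℝ) * eNorm g ^ 3) := by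
  rcases Nat.eq_zero_or_pos lam with rfl | hl
  · rw [Khat_zero_lam hχ0]
    simp
  have hl' : (0 : ℝ) < lam := by exact_mod_cast hl
  have hn := eNorm_pos hg
  have e1 (f : Vd 2) : (fun l => ((lam : ℝ) • f) l / (lam : ℝ)) = f := by
    funext l
    simp [hl'.ne']
  rw [Khat, e1, e1, h1, h2, eNorm_smul hl'.le, eNorm_smul hl'.le, eNorm_neg]
  simp only [Pi.smul_apply, Pi.neg_apply, smul_eq_mul]
  field_simp
  ring

lemma Thp_sub (a : Vd 2 → ℝ) (Φ : Vd 2 → Vd 2) (lam : ℕ) (η : Fin 2 → ℤ) (x h : Vd 2) :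
    Thp a Φ lam η (x - h)
      = Complex.exp (Complex.I * (((lam : ℝ) * ∑ j, Φ x j * (η j : ℝ) : ℝ) : ℂ))
        * ((a x : ℂ) + Ylam a Φ lam η x h)
        * Complex.exp (-(Complex.I * (((lam : ℝ) * ∑ l, gradT Φ η x l * h l : ℝ) : ℂ))) := by
  have e : (lam : ℝ) * ∑ j, Φ (x - h) j * (η j : ℝ)
      = lam * ∑ j, Φ x j * (η j : ℝ) + lam * ∑ j, RPhi Φ x h j * (η j : ℝ)
        - lam * ∑ l, gradT Φ η x l * h l := by
    simp only [RPhi, gradMul, gradT, Fin.sum_univ_two, Pi.add_apply, Pi.sub_apply]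
    ring
  have hexp (A B C : ℝ) : Complex.exp (Complex.I * ((A + B - C : ℝ) : ℂ))
      = Complex.exp (Complex.I * A) * Complex.exp (Complex.I * B)
        * Complex.exp (-(Complex.I * C)) := by
    rw [← Complex.exp_add, ← Complex.exp_add]
    push_cast
    ring_nf
  rw [Thp, Ylam, e, hexp]
  ring

lemma TorusFun.exists_bound {d : ℕ} {f : Vd d → ℂ} (hf : TorusFun f) (hc : Continuous f) :
    ∃ C, ∀ x, ‖f x‖ ≤ C := by
  obtain ⟨g, hg⟩ := hf.exists_lift hc
  exact ⟨‖g‖, fun x => hg x ▸ g.norm_coe_le_norm _⟩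

/-- The contribution of a pair `(η, ζ)` to `B_λ`, split into its leading part and the part
carried by `Y_λ^{η,ζ}`. -/
lemma integral_Thp_mul_Thp_mul_Kker {χ : Vd 2 → ℝ} {lam : ℕ} {i i' : Fin 2}
    (hK : Integrable fun h : Vd 2 × Vd 2 => Kker χ lam h i i')
    (hinv : ∀ ν : Vd 2 × Vd 2, ∫ h : Vd 2 × Vd 2, Kker χ lam h i i' *
      Complex.exp (-(Complex.I * (((∑ l, ν.1 l * h.1 l) + ∑ l, ν.2 l * h.2 l : ℝ) : ℂ)))
        = (Khat χ lam ν.1 ν.2 i i' : ℂ))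
    {a : Vd 2 → ℝ} (ha : Continuous a) (hap : TorusFun a) {Φ : Vd 2 → Vd 2} (hΦ : Continuous Φ)
    (hΦper : ∀ (x : Vd 2) (m : Fin 2 → ℤ), Φ (x + latt m) = Φ x + latt m)
    (η ζ : Fin 2 → ℤ) (x : Vd 2) :
    ∫ h : Vd 2 × Vd 2, Thp a Φ lam η (x - h.1) * Thp a Φ lam ζ (x - h.2) * Kker χ lam h i i'
      = Complex.exp (Complex.I * (((lam : ℝ) * ∑ j, Φ x j * ((η j + ζ j : ℤ) : ℝ) : ℝ) : ℂ))
          * ((a x : ℂ) ^ 2 * Khat χ lam ((lam : ℝ) • gradT Φ η x) ((lam : ℝ) • gradT Φ ζ x) i i')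
        + Complex.exp (Complex.I * (((lam : ℝ) * ∑ j, Φ x j * ((η j + ζ j : ℤ) : ℝ) : ℝ) : ℂ))
          * ∫ h : Vd 2 × Vd 2, Ypair a Φ lam η ζ x h.1 h.2 * Kker χ lam h i i'
            * Complex.exp (-(Complex.I *
                (((lam : ℝ) * ∑ l, gradT Φ η x l * h.1 l : ℝ) : ℂ)))
            * Complex.exp (-(Complex.I *
                (((lam : ℝ) * ∑ l, gradT Φ ζ x l * h.2 l : ℝ) : ℂ))) := by
  set E : ℂ := Complex.exp
    (Complex.I * (((lam : ℝ) * ∑ j, Φ x j * ((η j + ζ j : ℤ) : ℝ) : ℝ) : ℂ)) with hE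
  have hE' : E = Complex.exp (Complex.I * (((lam : ℝ) * ∑ j, Φ x j * (η j : ℝ) : ℝ) : ℂ))
      * Complex.exp (Complex.I * (((lam : ℝ) * ∑ j, Φ x j * (ζ j : ℝ) : ℝ) : ℂ)) := by
    rw [hE, ← Complex.exp_add]
    simp only [Fin.sum_univ_two]
    push_cast
    ring_nf
  have hE0 : E ≠ 0 := Complex.exp_ne_zero _
  let e (h : Vd 2 × Vd 2) : ℂ := Complex.exp (-(Complex.I * (((∑ l, ((lam : ℝ) • gradT Φ η x) l
    * h.1 l) + ∑ l, ((lam : ℝ) • gradT Φ ζ x) l * h.2 l : ℝ) : ℂ)))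
  have he (h : Vd 2 × Vd 2) : Complex.exp (-(Complex.I *
        (((lam : ℝ) * ∑ l, gradT Φ η x l * h.1 l : ℝ) : ℂ)))
      * Complex.exp (-(Complex.I * (((lam : ℝ) * ∑ l, gradT Φ ζ x l * h.2 l : ℝ) : ℂ)))
      = e h := by
    simp only [e]
    rw [← Complex.exp_add]
    simp only [Fin.sum_univ_two, Pi.smul_apply, smul_eq_mul]
    push_cast
    ring_nf
  have hec : Continuous e := by
    simp only [e]
    fun_prop
  have hnorm (h : Vd 2 × Vd 2) : ‖e h‖ ≤ 1 := by
    simp only [e]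
    rw [mul_comm, ← neg_mul, ← Complex.ofReal_neg, Complex.norm_exp_ofReal_mul_I]
  have hmain : Integrable fun h => Kker χ lam h i i' * e h :=
    hK.mul_bdd hec.aestronglyMeasurable (.of_forall hnorm)
  obtain ⟨C, hC⟩ := (torusFun_Thp hap hΦper lam η).exists_bound (continuous_Thp ha hΦ lam η)
  obtain ⟨D, hD⟩ := (torusFun_Thp hap hΦper lam ζ).exists_bound (continuous_Thp ha hΦ lam ζ)
  have hfull : Integrable fun h : Vd 2 × Vd 2 =>
      Thp a Φ lam η (x - h.1) * Thp a Φ lam ζ (x - h.2) * Kker χ lam h i i' := by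
    refine hK.bdd_mul (c := C * D) (Continuous.aestronglyMeasurable ?_) (.of_forall fun h => ?_)
    · exact ((continuous_Thp ha hΦ lam η).comp (by fun_prop)).mul
        ((continuous_Thp ha hΦ lam ζ).comp (by fun_prop))
    · rw [norm_mul]
      exact mul_le_mul (hC _) (hD _) (norm_nonneg _) ((norm_nonneg _).trans (hC 0))
  have hsplit (h : Vd 2 × Vd 2) : Ypair a Φ lam η ζ x h.1 h.2 * Kker χ lam h i i'
            * Complex.exp (-(Complex.I *
                (((lam : ℝ) * ∑ l, gradT Φ η x l * h.1 l : ℝ) : ℂ)))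
            * Complex.exp (-(Complex.I *
                (((lam : ℝ) * ∑ l, gradT Φ ζ x l * h.2 l : ℝ) : ℂ)))
      = E⁻¹ * (Thp a Φ lam η (x - h.1) * Thp a Φ lam ζ (x - h.2) * Kker χ lam h i i')
        - (a x : ℂ) ^ 2 * (Kker χ lam h i i' * e h) := by
    rw [eq_sub_iff_add_eq, eq_inv_mul_iff_mul_eq₀ hE0, Thp_sub, Thp_sub, ← he, hE', Ypair]
    ring
  simp_rw [hsplit]
  rw [integral_sub (hfull.const_mul _) (hmain.const_mul _), integral_const_mul,
    integral_const_mul, mul_sub, mul_inv_cancel_left₀ hE0,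
    hinv ((lam : ℝ) • gradT Φ η x, (lam : ℝ) • gradT Φ ζ x)]
  ring

lemma Bfield_eq_add_deltaB {χ : Vd 2 → ℝ} (hχsm : ContDiff ℝ (⊤ : ℕ∞) χ) {r r' : ℝ} (hr : 0 < r)
    (hχ : ∀ x, χ x ≠ 0 → r ≤ eNorm x ∧ eNorm x ≤ r') (hχ0 : χ 0 = 0) {lam : ℕ}
    {s : Finset (Fin 2 → ℤ)} (hs : ∀ k ∉ s, χ (fun i => (k i : ℝ) / (lam : ℝ)) = 0)
    {a : Vd 2 → ℝ} (ha : Continuous a) (hap : TorusFun a) {Φ : Vd 2 → Vd 2} (hΦ : Continuous Φ)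
    (hΦper : ∀ (x : Vd 2) (m : Fin 2 → ℤ), Φ (x + latt m) = Φ x + latt m)
    {ξ : Fin 2 → ℤ} (hξ : ξ ≠ 0) {x : Vd 2} (hg : gradT Φ ξ x ≠ 0)
    (hχ1 : χ (gradT Φ ξ x) = 1) (hχ2 : χ (-gradT Φ ξ x) = 1) (i i' : Fin 2) :
    Bfield χ a Φ lam ξ x i i'
      = (((1/4) * (a x) ^ 2 * (gradT Φ ξ x i * gradT Φ ξ x i')
          / ((lam : ℝ) * (eNorm (gradT Φ ξ x)) ^ 3) : ℝ) : ℂ)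
        + deltaB χ a Φ lam ξ x i i' := by
  obtain ⟨hK, hinv⟩ := integrable_and_inversion_Kker hχsm hr hχ lam i i'
  have hpair (η ζ : Fin 2 → ℤ) := bilinear_multiplier_eq_integral
    (G := fun ν₁ ν₂ => (Khat χ lam ν₁ ν₂ i i' : ℂ)) hK hinv s
    (fun j k h => by exact_mod_cast Khat_eq_zero hs h i i')
    (continuous_Thp ha hΦ lam η) (continuous_Thp ha hΦ lam ζ)
    (torusFun_Thp hap hΦper lam η) (torusFun_Thp hap hΦper lam ζ) x
  have hB : Bfield χ a Φ lam ξ x i i' = ∑ η ∈ ({ξ, -ξ} : Finset (Fin 2 → ℤ)),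
      ∑ ζ ∈ ({ξ, -ξ} : Finset (Fin 2 → ℤ)), ∫ h : Vd 2 × Vd 2,
        Thp a Φ lam η (x - h.1) * Thp a Φ lam ζ (x - h.2) * Kker χ lam h i i' := by
    simp_rw [Bfield, tsum_Khat_eq_sum hs, ← Finset.mul_sum]
    rw [← mul_assoc, show (1 / 16 : ℂ) * 16 = 1 by norm_num, one_mul]
    refine Finset.sum_congr rfl fun η _ => Finset.sum_congr rfl fun ζ _ => ?_
    rw [← hpair η ζ, Finset.sum_product_right]
    refine Finset.sum_congr rfl fun k _ => Finset.sum_congr rfl fun j _ => ?_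
    rw [Khat_symm, add_comm]
  have hneg := Khat_smul_neg hg hχ1 hχ2 hχ0 lam i i'
  have hneg' := (Khat_symm χ lam _ _ i i').trans hneg
  simp_rw [hB, integral_Thp_mul_Thp_mul_Kker hK hinv ha hap hΦ hΦper, Finset.sum_add_distrib,
    deltaB]
  congr 1
  simp only [Finset.sum_pair (neg_ne_self.mpr hξ).symm, gradT_neg, Khat_self, hneg, hneg']
  simp
  ring

/-- **bilinear microlocal lemma.** With
`θ_ξ = P_{≈λ}[a cos(λΦ·ξ)]`, the tensor field `B_λ` is smooth and symmetric, satisfies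
`∇^⊥Λ^{-1}θ_ξ · ∇θ_ξ = ∇^⊥·div B_λ`, and admits the expansion
`B_λ = (1/4) a² (∇Φ^Tξ⊗∇Φ^Tξ)/(λ|∇Φ^Tξ|³) + δB_λ`. -/
theorem bilinear_microlocal_lemma
    (r₁ r₂ r₁' r₂' : ℝ) (hr : 0 < r₁') (h₁ : r₁' ≤ r₁) (h₂ : r₁ ≤ r₂) (h₃ : r₂ ≤ r₂')
    (χ : Vd 2 → ℝ) (hχsm : ContDiff ℝ (⊤ : ℕ∞) χ)
    (hχone : ∀ x : Vd 2, r₁ ≤ eNorm x → eNorm x ≤ r₂ → χ x = 1)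
    (hχsupp : ∀ x : Vd 2, χ x ≠ 0 → r₁' ≤ eNorm x ∧ eNorm x ≤ r₂')
    (lam : ℕ) (ξ : Fin 2 → ℤ) (hξ : ξ ≠ 0)
    (a : Vd 2 → ℝ) (ha : ContDiff ℝ (⊤ : ℕ∞) a) (hap : TorusFun a)
    (Φ : Vd 2 → Vd 2) (hΦsm : ContDiff ℝ (⊤ : ℕ∞) Φ)
    (hΦper : ∀ (x : Vd 2) (m : Fin 2 → ℤ), Φ (x + latt m) = Φ x + latt m)
    (hΦdiffeo : ∃ Ψ : Vd 2 → Vd 2, ContDiff ℝ (⊤ : ℕ∞) Ψ ∧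
        Function.LeftInverse Ψ Φ ∧ Function.RightInverse Ψ Φ)
    (hfreq : ∀ x, r₁ ≤ eNorm (gradT Φ ξ x) ∧ eNorm (gradT Φ ξ x) ≤ r₂) :
    -- θ_ξ = P_{≈λ}[a cos(λΦ·ξ)]
    ∀ θξ : Vd 2 → ℂ,
      θξ = Pproj χ lam
        (fun x => ((a x * Real.cos ((lam : ℝ) * ∑ j, Φ x j * (ξ j : ℝ)) : ℝ) : ℂ)) →
      -- B_λ is smooth
      ContDiff ℝ (⊤ : ℕ∞) (fun x => (fun i i' => Bfield χ a Φ lam ξ x i i' :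
        Fin 2 → Fin 2 → ℂ)) ∧
      -- B_λ is symmetric
      (∀ x i i', Bfield χ a Φ lam ξ x i i' = Bfield χ a Φ lam ξ x i' i) ∧
      -- ∇^⊥Λ^{-1}θ_ξ · ∇θ_ξ = ∇^⊥·div B_λ
      (∀ x, (∑ i, sqgOp i θξ x * pd i θξ x)
        = perpDivDiv (fun y i i' => Bfield χ a Φ lam ξ y i i') x) ∧
      -- the expansion B_λ = (1/4)a²(∇Φ^Tξ⊗∇Φ^Tξ)/(λ|∇Φ^Tξ|³) + δB_λ
      (∀ x i i', Bfield χ a Φ lam ξ x i i'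
        = (((1/4) * (a x) ^ 2 * (gradT Φ ξ x i * gradT Φ ξ x i')
            / ((lam : ℝ) * (eNorm (gradT Φ ξ x)) ^ 3) : ℝ) : ℂ)
          + deltaB χ a Φ lam ξ x i i') := by
  intro θξ hθ
  have hχ0 : χ 0 = 0 := by
    by_contra h
    linarith [(hχsupp 0 h).1, eNorm_zero (d := 2)]
  have hfin := finite_dilated_support (fun x hx => (hχsupp x hx).2) hχ0 lam
  have hs : ∀ k ∉ hfin.toFinset, χ (fun i => (k i : ℝ) / (lam : ℝ)) = 0 := fun k hk => by
    simpa using hk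
  have hs0 : 0 ∉ hfin.toFinset := by
    have h0 : (fun _ => 0 : Vd 2) = 0 := rfl
    simp [h0, hχ0]
  refine ⟨contDiff_Bfield hs a Φ ξ, Bfield_comm χ a Φ lam ξ,
    sqg_nonlinearity_eq_perpDivDiv hs hs0 ha.continuous hΦsm.continuous hξ hθ,
    fun x i i' => ?_⟩
  have hg : gradT Φ ξ x ≠ 0 := fun h0 => by
    have := (hfreq x).1
    rw [h0, eNorm_zero] at this
    linarith
  have hneg := eNorm_neg (gradT Φ ξ x)
  exact Bfield_eq_add_deltaB hχsm hr hχsupp hχ0 hs ha.continuous hap hΦsm.continuous hΦper hξ hg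
    (hχone _ (hfreq x).1 (hfreq x).2) (hχone _ (hneg ▸ (hfreq x).1) (hneg ▸ (hfreq x).2)) i i'
end
end

section
/- Let Θ₁, Θ₂: 𝕋² → ℂ be smooth mean-zero functions and set θ = (Θ₁ + Θ₂)/2. Then ∇^⊥Λ^{−1}θ · ∇θ = (1/16) ∇^⊥ · Σ_{a,b ∈ {1,2}} (Q[Θ_a, Θ_b] + Q[Θ_b, Θ_a]), where Q[f,g] := Λ^{−1}f ∇g − f ∇Λ^{−1}g. In particular, the quadratic SQG interaction ∇^⊥Λ^{−1}θ·∇θ can be written, modulo gradients annihilated by ∇^⊥·, in terms of the symmetrized commutator-type bilinear expressions Q. -/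
/-!
Common setup: functions on the torus `𝕋^d = ℝ^d/(2πℤ)^d` are modelled as
`2π`-periodic functions on `ℝ^d = Fin d → ℝ`, with Fourier coefficients,
Fourier multiplier operators, Hölder norms, etc.
-/

noncomputable section

open scoped BigOperators
open MeasureTheory

/-- The commutator-type bilinear expression `Q[f,g] = Λ^{-1}f ∇g − f ∇Λ^{-1}g`
(a vector field). -/
def Qbil (f g : Vd 2 → ℂ) (x : Vd 2) (i : Fin 2) : ℂ :=
  LamPow (-1) f x * pd i g x - f x * pd i (LamPow (-1) g) x

/-- `∇^⊥·v = -∂₂v₁ + ∂₁v₂` for a (complex) vector field `v`. -/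
def perpDivC (v : Vd 2 → Fin 2 → ℂ) (x : Vd 2) : ℂ :=
  - pd 1 (fun y => v y 0) x + pd 0 (fun y => v y 1) x

/-- The vector field `∇^⊥Λ^{-1}f = (-∂₂Λ^{-1}f, ∂₁Λ^{-1}f)`. -/
def perpGradLamInv (f : Vd 2 → ℂ) (x : Vd 2) (i : Fin 2) : ℂ :=
  if i = 0 then -(pd 1 (LamPow (-1) f) x) else pd 0 (LamPow (-1) f) x

/-- The character `x ↦ e^{ik·x}`. -/
def charE {d : ℕ} (k : Fin d → ℤ) (x : Vd d) : ℂ := Complex.exp (Complex.I * (dotZ k x : ℂ))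

/-- `x ↦ k·x` as a continuous linear map. -/
def dotL {d : ℕ} (k : Fin d → ℤ) : Vd d →L[ℝ] ℝ :=
  ∑ i, (k i : ℝ) • ContinuousLinearMap.proj (R := ℝ) (φ := fun _ : Fin d => ℝ) i

lemma dotL_apply {d : ℕ} (k : Fin d → ℤ) (x : Vd d) : dotL k x = dotZ k x := by
  simp [dotL, dotZ]

lemma norm_dotL_le {d : ℕ} (k : Fin d → ℤ) : ‖dotL k‖ ≤ d * ‖k‖ := by
  refine ContinuousLinearMap.opNorm_le_bound _ (by positivity) fun x => ?_
  rw [dotL_apply, dotZ]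
  calc ‖∑ i, (k i : ℝ) * x i‖ ≤ ∑ i : Fin d, ‖k‖ * ‖x‖ := by
        refine norm_sum_le_of_le _ fun i _ => ?_
        rw [norm_mul]
        gcongr
        · exact (Int.norm_eq_abs (k i) ▸ norm_le_pi_norm k i : ‖(k i : ℝ)‖ ≤ ‖k‖)
        · exact norm_le_pi_norm x i
    _ = d * ‖k‖ * ‖x‖ := by simp [mul_assoc]

lemma charE_eq_comp {d : ℕ} (k : Fin d → ℤ) :
    charE k = (fun t : ℝ => Complex.exp (Complex.I * t)) ∘ dotL k := by
  ext x
  simp [charE, dotL_apply]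

lemma contDiff_exp_I_mul {n : WithTop ℕ∞} :
    ContDiff ℝ n fun t : ℝ => Complex.exp (Complex.I * t) :=
  (contDiff_const.mul Complex.ofRealCLM.contDiff).cexp

lemma contDiff_charE {d : ℕ} (k : Fin d → ℤ) {n : WithTop ℕ∞} : ContDiff ℝ n (charE k) := by
  rw [charE_eq_comp]
  exact contDiff_exp_I_mul.comp (dotL k).contDiff

lemma norm_charE {d : ℕ} (k : Fin d → ℤ) (x : Vd d) : ‖charE k x‖ = 1 := by
  rw [charE, mul_comm, Complex.norm_exp_ofReal_mul_I]

lemma hasDerivAt_exp_I_mul (t : ℝ) :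
    HasDerivAt (fun t : ℝ => Complex.exp (Complex.I * t))
      (Complex.I * Complex.exp (Complex.I * t)) t := by
  simpa [mul_comm] using ((Complex.ofRealCLM.hasDerivAt (x := t)).const_mul Complex.I).cexp

lemma iteratedDeriv_exp_I_mul (n : ℕ) :
    iteratedDeriv n (fun t : ℝ => Complex.exp (Complex.I * t)) =
      fun t : ℝ => Complex.I ^ n * Complex.exp (Complex.I * t) := by
  induction n with
  | zero => simp
  | succ n ih =>
    ext t
    rw [iteratedDeriv_succ, ih, ((hasDerivAt_exp_I_mul t).const_mul _).deriv]
    ring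

lemma norm_iteratedFDeriv_charE_le {d : ℕ} (k : Fin d → ℤ) (n : ℕ) (x : Vd d) :
    ‖iteratedFDeriv ℝ n (charE k) x‖ ≤ (d * ‖k‖) ^ n := by
  rw [charE_eq_comp, (dotL k).iteratedFDeriv_comp_right (contDiff_exp_I_mul (n := n)) x le_rfl]
  refine (ContinuousMultilinearMap.norm_compContinuousLinearMap_le _ _).trans ?_
  rw [norm_iteratedFDeriv_eq_norm_iteratedDeriv, iteratedDeriv_exp_I_mul]
  have h : ‖Complex.exp (Complex.I * (dotL k x : ℝ))‖ = 1 := by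
    rw [mul_comm, Complex.norm_exp_ofReal_mul_I]
  simp only [norm_mul, norm_pow, Complex.norm_I, one_pow, h, Finset.prod_const,
    Finset.card_univ, Fintype.card_fin, one_mul]
  gcongr
  exact norm_dotL_le k

lemma pd_charE {d : ℕ} (k : Fin d → ℤ) (i : Fin d) (x : Vd d) :
    pd i (charE k) x = Complex.I * k i * charE k x := by
  have h := (hasDerivAt_exp_I_mul (dotL k x)).hasFDerivAt.comp x (dotL k).hasFDerivAt
  rw [← charE_eq_comp] at h
  rw [pd, h.fderiv]
  simp [dotL_apply, dotZ, charE, Pi.single_apply]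
  ring

lemma torusFun_charE {d : ℕ} (k : Fin d → ℤ) : TorusFun (charE k) := by
  intro x m
  rw [charE, charE, Complex.exp_eq_exp_iff_exists_int]
  refine ⟨∑ i, k i * m i, ?_⟩
  simp only [dotZ, latt, Pi.add_apply, mul_add, Finset.sum_add_distrib]
  push_cast
  rw [mul_add, add_right_inj, Finset.mul_sum, Finset.sum_mul]
  exact Finset.sum_congr rfl fun i _ => by ring

lemma pd_mul {d : ℕ} {f g : Vd d → ℂ} {x : Vd d} (i : Fin d)
    (hf : DifferentiableAt ℝ f x) (hg : DifferentiableAt ℝ g x) :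
    pd i (fun y => f y * g y) x = f x * pd i g x + pd i f x * g x := by
  simp [pd, fderiv_fun_mul hf hg, mul_comm]

lemma contDiff_pd {d : ℕ} {f : Vd d → ℂ} {m n : WithTop ℕ∞} (hf : ContDiff ℝ n f)
    (hmn : m + 1 ≤ n) (i : Fin d) : ContDiff ℝ m (pd i f) :=
  (hf.fderiv_right hmn).clm_apply contDiff_const

lemma torusFun_pd {d : ℕ} {f : Vd d → ℂ} (hf : TorusFun f) (i : Fin d) : TorusFun (pd i f) := by
  intro x m
  rw [pd, pd, ← fderiv_comp_add_right (f := f) (latt m)]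
  simp only [hf _ m]

/-- The integral over a period of a derivative of a periodic function vanishes. -/
lemma integral_box_pd {d : ℕ} {f : Vd d → ℂ} (hf : ContDiff ℝ 1 f) (hp : TorusFun f)
    (i : Fin d) : ∫ x in box d, pd i f x = 0 := by
  obtain _ | d := d
  · exact i.elim0
  have hc : Continuous (pd i f) := (contDiff_pd (m := 0) hf (by simp) i).continuous
  have hsum (x : Vd (d + 1)) :
      ∑ j, (if j = i then fderiv ℝ f x else 0) (Pi.single j 1) = pd i f x := by
    rw [Finset.sum_eq_single i (by intro j _ hj; simp [hj]) (by simp)]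
    simp [pd]
  have key := integral_divergence_of_hasFDerivAt_off_countable' (0 : Vd (d + 1))
    (fun _ => 2 * Real.pi) (fun _ => by simp; positivity)
    (fun j => if j = i then f else 0) (fun j x => if j = i then fderiv ℝ f x else 0) ∅
    Set.countable_empty
    (fun j => by split_ifs; exacts [hf.continuous.continuousOn, continuousOn_const])
    (fun x _ j => by
      split_ifs
      exacts [(hf.differentiable one_ne_zero x).hasFDerivAt, hasFDerivAt_const _ _])
    (by simp only [hsum]; exact hc.continuousOn.integrableOn_compact isCompact_Icc)
  simp only [hsum] at key
  rw [box, key]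
  refine Finset.sum_eq_zero fun j _ => ?_
  split_ifs with hj
  · rw [sub_eq_zero]
    congr 1
    ext y
    rw [← hp (j.insertNth ((0 : Vd (d + 1)) j) y) (Pi.single j 1)]
    congr 1
    ext l
    refine Fin.succAboveCases j ?_ (fun l => ?_) l <;> simp [latt]
  · simp

lemma exp_neg_eq_charE {d : ℕ} (k : Fin d → ℤ) (x : Vd d) :
    Complex.exp (-(Complex.I * (dotZ k x : ℂ))) = charE (-k) x := by
  simp [charE, dotZ]

lemma fCoeff_pd {d : ℕ} {f : Vd d → ℂ} (hf : ContDiff ℝ 1 f) (hp : TorusFun f)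
    (i : Fin d) (k : Fin d → ℤ) : fCoeff (pd i f) k = Complex.I * k i * fCoeff f k := by
  have hE : ContDiff ℝ 1 (charE (-k)) := contDiff_charE _
  have h0 := integral_box_pd (hf.mul hE)
    (fun x m => by simp only [hp x m, torusFun_charE (-k) x m]) i
  have hint {g : Vd d → ℂ} (hg : Continuous g) : IntegrableOn g (box d) :=
    hg.continuousOn.integrableOn_compact isCompact_Icc
  have hpd (x : Vd d) : pd i (fun y => f y * charE (-k) y) x =
      pd i f x * charE (-k) x - Complex.I * k i * (f x * charE (-k) x) := by
    rw [pd_mul i (hf.differentiable one_ne_zero x) (hE.differentiable one_ne_zero x), pd_charE]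
    simp
    ring
  simp only [hpd] at h0
  have hc : Continuous (pd i f) := (contDiff_pd (m := 0) hf (by simp) i).continuous
  rw [integral_sub (hint (g := fun x => pd i f x * charE (-k) x) (hc.mul hE.continuous))
    (hint (g := fun x => Complex.I * k i * (f x * charE (-k) x))
      (continuous_const.mul (hf.continuous.mul hE.continuous))), integral_const_mul,
    sub_eq_zero] at h0
  simp only [fCoeff, exp_neg_eq_charE]
  rw [h0, mul_smul_comm]

lemma exists_norm_fCoeff_le {d : ℕ} (f : Vd d → ℂ) :
    ∃ C, ∀ k, ‖fCoeff f k‖ ≤ C := by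
  refine ⟨‖(((2 * Real.pi) ^ d)⁻¹ : ℝ)‖ * ∫ x in box d, ‖f x‖, fun k => ?_⟩
  rw [fCoeff, norm_smul]
  gcongr
  refine (norm_integral_le_integral_norm _).trans_eq ?_
  simp [exp_neg_eq_charE, norm_charE]

lemma exists_abs_pow_mul_norm_fCoeff_le {d : ℕ} (i : Fin d) (n : ℕ) {f : Vd d → ℂ}
    (hf : ContDiff ℝ n f) (hp : TorusFun f) :
    ∃ C, ∀ k : Fin d → ℤ, |(k i : ℝ)| ^ n * ‖fCoeff f k‖ ≤ C := by
  induction n generalizing f with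
  | zero => simpa using exists_norm_fCoeff_le f
  | succ n ih =>
    obtain ⟨C, hC⟩ := ih (contDiff_pd hf (by norm_cast) i) (torusFun_pd hp i)
    refine ⟨C, fun k => (hC k).trans_eq' ?_⟩
    rw [fCoeff_pd (hf.of_le (by norm_cast; omega)) hp]
    simp [pow_succ, mul_assoc]

/-- Fourier coefficients of a `C^n` function decay like `|k|^{-n}`. -/
lemma exists_norm_pow_mul_norm_fCoeff_le {d : ℕ} (n : ℕ) {f : Vd d → ℂ}
    (hf : ContDiff ℝ n f) (hp : TorusFun f) :
    ∃ C, ∀ k : Fin d → ℤ, k ≠ 0 → ‖k‖ ^ n * ‖fCoeff f k‖ ≤ C := by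
  choose C hC using fun i => exists_abs_pow_mul_norm_fCoeff_le i n hf hp
  refine ⟨∑ i, |C i|, fun k hk => ?_⟩
  have : Nonempty (Fin d) := by
    by_contra h
    rw [not_nonempty_iff] at h
    exact hk (Subsingleton.elim _ _)
  obtain ⟨i, hi⟩ := Finite.exists_max fun i => ‖k i‖
  have hki : ‖k‖ ≤ |(k i : ℝ)| := by
    rw [← Int.norm_eq_abs]
    exact (pi_norm_le_iff_of_nonneg (norm_nonneg _)).2 hi
  calc ‖k‖ ^ n * ‖fCoeff f k‖ ≤ |(k i : ℝ)| ^ n * ‖fCoeff f k‖ := by gcongr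
    _ ≤ |C i| := (hC i k).trans (le_abs_self _)
    _ ≤ ∑ i, |C i| := Finset.single_le_sum (f := fun i => |C i|) (fun _ _ => abs_nonneg _)
        (Finset.mem_univ i)

/-- The symbol of `Λ^s`. -/
def lamSymbol {d : ℕ} (s : ℝ) (k : Fin d → ℤ) : ℂ :=
  if k = 0 then 0 else (((kAbs k) ^ s : ℝ) : ℂ)

lemma one_le_kAbs {d : ℕ} {k : Fin d → ℤ} (hk : k ≠ 0) : 1 ≤ kAbs k := by
  obtain ⟨i, hi⟩ := Function.ne_iff.1 hk
  rw [kAbs, eNorm, Real.one_le_sqrt]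
  have h : (1 : ℝ) ≤ (k i : ℝ) ^ 2 := by
    exact_mod_cast Int.one_le_abs (pow_ne_zero 2 hi) |>.trans_eq (abs_of_nonneg (sq_nonneg _))
  exact h.trans (Finset.single_le_sum (f := fun i => (k i : ℝ) ^ 2)
    (fun _ _ => sq_nonneg _) (Finset.mem_univ i))

lemma norm_lamSymbol_le {d : ℕ} {s : ℝ} (hs : s ≤ 0) (k : Fin d → ℤ) :
    ‖lamSymbol s k‖ ≤ 1 := by
  rw [lamSymbol]
  split_ifs with hk
  · simp
  · have h1 := one_le_kAbs hk
    rw [Complex.norm_real, Real.norm_of_nonneg (by positivity)]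
    exact Real.rpow_le_one_of_one_le_of_nonpos h1 hs

lemma summable_norm_lamSymbol_mul_fCoeff {s : ℝ} (hs : s ≤ 0) (n : ℕ) {f : Vd 2 → ℂ}
    (hf : ContDiff ℝ (n + 3 : ℕ) f) (hp : TorusFun f) :
    Summable fun k : Fin 2 → ℤ => ‖lamSymbol s k * fCoeff f k‖ * (2 * ‖k‖) ^ n := by
  obtain ⟨C, hC⟩ := exists_norm_pow_mul_norm_fCoeff_le (n + 3) hf hp
  refine Summable.of_nonneg_of_le (fun k => by positivity) (fun k => ?_)
    ((EisensteinSeries.summable_one_div_norm_rpow (k := 3) (by norm_num)).mul_left (2 ^ n * C))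
  by_cases hk : k = 0
  · simp [hk, lamSymbol]
  have hk0 : 0 < ‖k‖ := norm_pos_iff.2 hk
  rw [Real.rpow_neg hk0.le, ← div_eq_mul_inv, le_div_iff₀ (by positivity)]
  rw [Real.rpow_ofNat]
  calc ‖lamSymbol s k * fCoeff f k‖ * (2 * ‖k‖) ^ n * ‖k‖ ^ 3
      = ‖lamSymbol s k‖ * (2 ^ n * (‖k‖ ^ (n + 3) * ‖fCoeff f k‖)) := by
        rw [norm_mul]; ring
    _ ≤ 1 * (2 ^ n * C) := by
        have := hC k hk
        have h0 : 0 ≤ ‖k‖ ^ (n + 3) * ‖fCoeff f k‖ := by positivity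
        gcongr
        · exact norm_lamSymbol_le hs k
    _ = 2 ^ n * C := one_mul _

lemma LamPow_apply {d : ℕ} (s : ℝ) (f : Vd d → ℂ) (x : Vd d) :
    LamPow s f x = ∑' k, lamSymbol s k * fCoeff f k * charE k x := rfl

lemma contDiff_LamPow {s : ℝ} (hs : s ≤ 0) {f : Vd 2 → ℂ}
    (hf : ContDiff ℝ (⊤ : ℕ∞) f) (hp : TorusFun f) : ContDiff ℝ (⊤ : ℕ∞) (LamPow s f) := by
  refine contDiff_tsum
    (v := fun n (k : Fin 2 → ℤ) => ‖lamSymbol s k * fCoeff f k‖ * (2 * ‖k‖) ^ n)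
    (fun k => contDiff_const.mul (contDiff_charE k))
    (fun n _ => summable_norm_lamSymbol_mul_fCoeff hs n (contDiff_infty.1 hf _) hp)
    (fun n k x _ => ?_)
  have h := iteratedFDeriv_const_smul_apply (𝕜 := ℝ) (i := n) (x := x)
    (a := lamSymbol s k * fCoeff f k) (f := charE k) (contDiff_charE k).contDiffAt
  change ‖iteratedFDeriv ℝ n ((lamSymbol s k * fCoeff f k) • charE k) x‖ ≤ _
  rw [h, norm_smul]
  gcongr
  exact_mod_cast norm_iteratedFDeriv_charE_le k n x

lemma fCoeff_add_div_two {d : ℕ} {f g : Vd d → ℂ} (hf : Continuous f) (hg : Continuous g)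
    (k : Fin d → ℤ) :
    fCoeff (fun y => (f y + g y) / 2) k = (fCoeff f k + fCoeff g k) / 2 := by
  have hint {g : Vd d → ℂ} (hg : Continuous g) :
      IntegrableOn (fun x => g x * charE (-k) x) (box d) :=
    (hg.mul (contDiff_charE (n := 0) _).continuous).continuousOn.integrableOn_compact
      isCompact_Icc
  simp only [fCoeff, exp_neg_eq_charE]
  rw [← smul_add, ← integral_add (hint hf) (hint hg), smul_div_assoc, ← integral_div]
  congr 2
  ext x
  ring

lemma LamPow_add_div_two {s : ℝ} (hs : s ≤ 0) {f g : Vd 2 → ℂ}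
    (hf : ContDiff ℝ (⊤ : ℕ∞) f) (hg : ContDiff ℝ (⊤ : ℕ∞) g) (hpf : TorusFun f)
    (hpg : TorusFun g) :
    LamPow s (fun y => (f y + g y) / 2) = fun y => (LamPow s f y + LamPow s g y) / 2 := by
  ext x
  have hsum {h : Vd 2 → ℂ} (hh : ContDiff ℝ (⊤ : ℕ∞) h) (hp : TorusFun h) :
      Summable fun k => lamSymbol s k * fCoeff h k * charE k x := by
    refine Summable.of_norm ?_
    simpa [norm_charE] using
      summable_norm_lamSymbol_mul_fCoeff hs 0 (contDiff_infty.1 hh _) hp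
  simp only [LamPow_apply]
  rw [← (hsum hf hpf).tsum_add (hsum hg hpg), ← tsum_div_const]
  refine tsum_congr fun k => ?_
  rw [fCoeff_add_div_two hf.continuous hg.continuous]
  ring

lemma pd_add_div_two {d : ℕ} {f g : Vd d → ℂ} {x : Vd d} (i : Fin d)
    (hf : DifferentiableAt ℝ f x) (hg : DifferentiableAt ℝ g x) :
    pd i (fun y => (f y + g y) / 2) x = (pd i f x + pd i g x) / 2 := by
  simp only [div_eq_mul_inv]
  rw [pd, fderiv_mul_const (hf.fun_add hg), fderiv_fun_add hf hg]
  simp [pd, mul_add, mul_comm]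

lemma pd_comm {d : ℕ} {f : Vd d → ℂ} (hf : ContDiff ℝ 2 f) (i j : Fin d) (x : Vd d) :
    pd i (pd j f) x = pd j (pd i f) x := by
  have hd : DifferentiableAt ℝ (fderiv ℝ f) x :=
    (hf.fderiv_right (m := 1) (by norm_num)).differentiable one_ne_zero x
  have h (i j : Fin d) :
      pd i (pd j f) x = fderiv ℝ (fderiv ℝ f) x (Pi.single i 1) (Pi.single j 1) := by
    unfold pd
    rw [fderiv_clm_apply hd (differentiableAt_const _)]
    simp
  rw [h, h]
  exact (hf.contDiffAt.isSymmSndFDerivAt (by simp)).eq _ _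

/-- `∇^⊥·(φ∇θ − θ∇φ) = 2 ∇^⊥φ·∇θ`. -/
lemma perpDivC_mul_grad_sub {φ θ : Vd 2 → ℂ} (hφ : ContDiff ℝ 2 φ) (hθ : ContDiff ℝ 2 θ)
    (c : ℂ) (x : Vd 2) :
    perpDivC (fun y i => c * (φ y * pd i θ y - θ y * pd i φ y)) x =
      2 * c * (-(pd 1 φ x) * pd 0 θ x + pd 0 φ x * pd 1 θ x) := by
  have hd {f : Vd 2 → ℂ} (hf : ContDiff ℝ 2 f) : DifferentiableAt ℝ f x :=
    hf.differentiable two_ne_zero x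
  have hd' {f : Vd 2 → ℂ} (hf : ContDiff ℝ 2 f) (i : Fin 2) : DifferentiableAt ℝ (pd i f) x :=
    (contDiff_pd (m := 1) hf (by norm_num) i).differentiable one_ne_zero x
  have h (i j : Fin 2) : pd j (fun y => c * (φ y * pd i θ y - θ y * pd i φ y)) x =
      c * ((φ x * pd j (pd i θ) x + pd j φ x * pd i θ x)
        - (θ x * pd j (pd i φ) x + pd j θ x * pd i φ x)) := by
    rw [← pd_mul j (hd hφ) (hd' hθ i), ← pd_mul j (hd hθ) (hd' hφ i), pd,
      fderiv_const_mul (((hd hφ).fun_mul (hd' hθ i)).fun_sub ((hd hθ).fun_mul (hd' hφ i))),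
      fderiv_fun_sub ((hd hφ).fun_mul (hd' hθ i)) ((hd hθ).fun_mul (hd' hφ i))]
    simp [pd]
  rw [perpDivC, h, h, pd_comm hφ 1 0, pd_comm hθ 1 0]
  ring

/-- For smooth mean-zero `Θ₁, Θ₂` and `θ = (Θ₁+Θ₂)/2`,
`∇^⊥Λ^{-1}θ · ∇θ = (1/16) ∇^⊥· Σ_{a,b∈{1,2}} (Q[Θ_a,Θ_b] + Q[Θ_b,Θ_a])`. -/
theorem sqg_interaction_via_Q (Θ₁ Θ₂ : Vd 2 → ℂ)
    (h1 : ContDiff ℝ (⊤ : ℕ∞) Θ₁) (h2 : ContDiff ℝ (⊤ : ℕ∞) Θ₂)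
    (hp1 : TorusFun Θ₁) (hp2 : TorusFun Θ₂)
    (hm1 : fCoeff Θ₁ 0 = 0) (hm2 : fCoeff Θ₂ 0 = 0) :
    ∀ x : Vd 2,
      (∑ i, perpGradLamInv (fun y => (Θ₁ y + Θ₂ y) / 2) x i *
            pd i (fun y => (Θ₁ y + Θ₂ y) / 2) x)
        = (1/16 : ℂ) * perpDivC (fun y i =>
            ∑ a : Fin 2, ∑ b : Fin 2,
              (Qbil (![Θ₁, Θ₂] a) (![Θ₁, Θ₂] b) y i
               + Qbil (![Θ₁, Θ₂] b) (![Θ₁, Θ₂] a) y i)) x := by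
  intro x
  have hs : (-1 : ℝ) ≤ 0 := by norm_num
  have k1 := contDiff_LamPow hs h1 hp1
  have k2 := contDiff_LamPow hs h2 hp2
  have two {f : Vd 2 → ℂ} (hf : ContDiff ℝ (⊤ : ℕ∞) f) : ContDiff ℝ 2 f :=
    contDiff_infty.1 hf 2
  have hd {f : Vd 2 → ℂ} (hf : ContDiff ℝ (⊤ : ℕ∞) f) (y : Vd 2) : DifferentiableAt ℝ f y :=
    (two hf).differentiable two_ne_zero y
  have hQ : (fun y i => ∑ a : Fin 2, ∑ b : Fin 2,
      (Qbil (![Θ₁, Θ₂] a) (![Θ₁, Θ₂] b) y i + Qbil (![Θ₁, Θ₂] b) (![Θ₁, Θ₂] a) y i)) =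
      fun y i => 8 * ((LamPow (-1) Θ₁ y + LamPow (-1) Θ₂ y) / 2 *
          pd i (fun y => (Θ₁ y + Θ₂ y) / 2) y -
        (Θ₁ y + Θ₂ y) / 2 *
          pd i (fun y => (LamPow (-1) Θ₁ y + LamPow (-1) Θ₂ y) / 2) y) := by
    ext y i
    rw [pd_add_div_two i (hd h1 y) (hd h2 y), pd_add_div_two i (hd k1 y) (hd k2 y)]
    simp only [Fin.sum_univ_two, Matrix.cons_val_zero, Matrix.cons_val_one, Qbil]
    ring
  rw [hQ, perpDivC_mul_grad_sub (((two k1).add (two k2)).div_const 2)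
    (((two h1).add (two h2)).div_const 2)]
  simp only [Fin.sum_univ_two, perpGradLamInv, LamPow_add_div_two hs h1 h2 hp1 hp2, if_true,
    one_ne_zero, if_false]
  ring
end
end
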